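/- arXiv:1604.08817 — 3 statements merged into one kernel-verified Lean document; each statement's English description precedes it below -/
import Mathlib

section
/- Let β be any one of the parameters μ, ν, ξ, tw, la, pw, ppw. Then for all integers r ≥ 2 and n ≥ 2r, NGΣ↓_β(r;n) ≤ NGΣ↓ⁿ_β(r;n) ≤ n − r; moreover the value n − r is realized by a non-degenerate r-decomposition of K_n in which all but at most one of the graphs are paths (together with isolated vertices). -/
open scoped Classical

namespace NG

/-- The set of earlier neighbors (back-neighborhood) of vertex `j` in `H`,
with respect to the natural order on `Fin N`. -/
noncomputable def backNbhd {N : ℕ} (H : SimpleGraph (Fin N)) (j : Fin N) :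
    Finset (Fin N) :=
  Finset.univ.filter (fun i => (i : ℕ) < (j : ℕ) ∧ H.Adj i j)

/-- The degree of `u` in the subgraph of `H` induced on the first `j` vertices
(the "stage `j`" graph of the construction). -/
noncomputable def stageDeg {N : ℕ} (H : SimpleGraph (Fin N)) (j : ℕ) (u : Fin N) : ℕ :=
  (Finset.univ.filter (fun w : Fin N => (w : ℕ) < j ∧ (u : ℕ) < j ∧ H.Adj u w)).card

/-- `H` on `Fin N` is a `k`-tree, built in the natural vertex order: the first
`k+1` vertices form a clique, and every later vertex is joined exactly to the
vertices of an existing `k`-clique. -/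
def IsKTreeOrd (k : ℕ) (N : ℕ) (H : SimpleGraph (Fin N)) : Prop :=
  1 ≤ k ∧ k + 1 ≤ N ∧
  (∀ i j : Fin N, (i : ℕ) < (j : ℕ) → (j : ℕ) ≤ k → H.Adj i j) ∧
  (∀ j : Fin N, k < (j : ℕ) →
    (backNbhd H j).card = k ∧ H.IsClique (backNbhd H j : Set (Fin N)))

/-- A linear `k`-tree: a `k`-tree in which each new vertex (after the first added
one) is joined to a `k`-clique containing the vertex added at the previous step. -/
def IsLinearKTreeOrd (k : ℕ) (N : ℕ) (H : SimpleGraph (Fin N)) : Prop :=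
  IsKTreeOrd k N H ∧
  ∀ i j : Fin N, (i : ℕ) + 1 = (j : ℕ) → k + 1 < (j : ℕ) → i ∈ backNbhd H j

/-- A `k`-caterpillar: a `k`-tree in which each new vertex (after the first added
one) is joined to a `k`-clique contained in the maximal `(k+1)`-clique created at
the previous stage. -/
def IsCaterpillarOrd (k : ℕ) (N : ℕ) (H : SimpleGraph (Fin N)) : Prop :=
  IsKTreeOrd k N H ∧
  ∀ i j : Fin N, (i : ℕ) + 1 = (j : ℕ) → k + 1 < (j : ℕ) →
    backNbhd H j ⊆ insert i (backNbhd H i)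

/-- A two-sided `k`-tree: a `k`-tree in which each new vertex is joined to a
`k`-clique that either contains a vertex of degree `k` (at that stage) or equals
the `k`-clique to which some previously added vertex was joined. -/
def IsTwoSidedKTreeOrd (k : ℕ) (N : ℕ) (H : SimpleGraph (Fin N)) : Prop :=
  IsKTreeOrd k N H ∧
  ∀ j : Fin N, k < (j : ℕ) →
    ((∃ u ∈ backNbhd H j, stageDeg H (j : ℕ) u = k) ∨
     (∃ i : Fin N, k < (i : ℕ) ∧ (i : ℕ) < (j : ℕ) ∧ backNbhd H i = backNbhd H j))

/-- The least `k` such that `G` embeds as a subgraph into some graph in the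
class `P k`; an edgeless graph gets the value `0`. -/
noncomputable def widthParam (P : ℕ → (N : ℕ) → SimpleGraph (Fin N) → Prop)
    (n : ℕ) (G : SimpleGraph (Fin n)) : ℕ :=
  if G = ⊥ then 0
  else sInf {k | ∃ (N : ℕ) (H : SimpleGraph (Fin N)) (f : Fin n ↪ Fin N),
    P k N H ∧ ∀ u v : Fin n, G.Adj u v → H.Adj (f u) (f v)}

/-- Tree-width: the least `k` such that `G` is a subgraph of a `k`-tree. -/
noncomputable def treewidth (n : ℕ) (G : SimpleGraph (Fin n)) : ℕ :=
  widthParam IsKTreeOrd n G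

/-- Largeur d'arborescence: the least `k` such that `G` is a subgraph of a
two-sided `k`-tree. -/
noncomputable def la (n : ℕ) (G : SimpleGraph (Fin n)) : ℕ :=
  widthParam IsTwoSidedKTreeOrd n G

/-- Path-width: the least `k` such that `G` is a subgraph of a `k`-caterpillar. -/
noncomputable def pw (n : ℕ) (G : SimpleGraph (Fin n)) : ℕ :=
  widthParam IsCaterpillarOrd n G

/-- Proper path-width: the least `k` such that `G` is a subgraph of a linear
`k`-tree. -/
noncomputable def ppw (n : ℕ) (G : SimpleGraph (Fin n)) : ℕ :=
  widthParam IsLinearKTreeOrd n G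

/-- `G` has a complete-graph minor on `m` branch sets: there are `m` pairwise
disjoint nonempty connected vertex sets with an edge between every two of them. -/
def HasCliqueMinor {n : ℕ} (G : SimpleGraph (Fin n)) (m : ℕ) : Prop :=
  ∃ B : Fin m → Finset (Fin n),
    (∀ p, (B p).Nonempty) ∧
    (∀ p, (G.induce ((B p : Finset (Fin n)) : Set (Fin n))).Connected) ∧
    (∀ p q, p ≠ q → Disjoint (B p) (B q)) ∧
    (∀ p q, p ≠ q → ∃ u ∈ B p, ∃ v ∈ B q, G.Adj u v)

/-- The Hadwiger number: the largest `m` such that `K_m` is a minor of `G`. -/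
noncomputable def hadwiger (n : ℕ) (G : SimpleGraph (Fin n)) : ℕ :=
  sSup {m | HasCliqueMinor G m}

/-- `A` is a symmetric matrix whose off-diagonal nonzero pattern is the
adjacency of `G`. -/
def DescribesGraph {n : ℕ} (A : Matrix (Fin n) (Fin n) ℝ)
    (G : SimpleGraph (Fin n)) : Prop :=
  A.IsSymm ∧ ∀ i j : Fin n, i ≠ j → (A i j ≠ 0 ↔ G.Adj i j)

/-- The Strong Arnold Property: the only symmetric `X` with `AX = O`,
`A∘X = O` and `I∘X = O` is `X = O`. -/
def StrongArnold {n : ℕ} (A : Matrix (Fin n) (Fin n) ℝ) : Prop :=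
  ∀ X : Matrix (Fin n) (Fin n) ℝ, X.IsSymm → A * X = 0 →
    (∀ i j, A i j * X i j = 0) → (∀ i, X i i = 0) → X = 0

/-- The nullity of a square real matrix. -/
noncomputable def nullity {n : ℕ} (A : Matrix (Fin n) (Fin n) ℝ) : ℕ :=
  Module.finrank ℝ (LinearMap.ker (Matrix.toLin' A))

/-- The Colin de Verdière type parameter `ξ`: maximum nullity of a matrix in
`S(G)` with the Strong Arnold Property. -/
noncomputable def xiParam (n : ℕ) (G : SimpleGraph (Fin n)) : ℕ :=
  sSup {m | ∃ A : Matrix (Fin n) (Fin n) ℝ,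
    DescribesGraph A G ∧ StrongArnold A ∧ nullity A = m}

/-- The Colin de Verdière type parameter `ν`: maximum nullity of a positive
semidefinite matrix in `S(G)` with the Strong Arnold Property. -/
noncomputable def nuParam (n : ℕ) (G : SimpleGraph (Fin n)) : ℕ :=
  sSup {m | ∃ A : Matrix (Fin n) (Fin n) ℝ,
    DescribesGraph A G ∧ A.PosSemidef ∧ StrongArnold A ∧ nullity A = m}

/-- The Colin de Verdière number `μ`: maximum nullity of a generalized
Laplacian in `S(G)` with exactly one negative eigenvalue and the Strong Arnold
Property. -/
noncomputable def muParam (n : ℕ) (G : SimpleGraph (Fin n)) : ℕ :=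
  sSup {m | ∃ (A : Matrix (Fin n) (Fin n) ℝ) (hA : A.IsHermitian),
    DescribesGraph A G ∧ StrongArnold A ∧
    (Finset.univ.filter (fun i => hA.eigenvalues i < 0)).card = 1 ∧
    (∀ i j : Fin n, i ≠ j → A i j ≤ 0) ∧ nullity A = m}

/-- An `r`-decomposition of `K_n`: spanning subgraphs with pairwise disjoint
edge sets whose union is all of `K_n`. -/
def IsDecomp {n r : ℕ} (G : Fin r → SimpleGraph (Fin n)) : Prop :=
  (∀ i j : Fin r, i ≠ j → Disjoint (G i) (G j)) ∧ (⨆ i, G i) = ⊤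

/-- A non-degenerate `r`-decomposition: every part has at least one edge. -/
def IsNDDecomp {n r : ℕ} (G : Fin r → SimpleGraph (Fin n)) : Prop :=
  IsDecomp G ∧ ∀ i, G i ≠ ⊥

/-- Nordhaus–Gaddum sum upper bound `NGΣ↑_β(r;n)`. -/
noncomputable def NGsumUp {n : ℕ} (β : SimpleGraph (Fin n) → ℕ) (r : ℕ) : ℕ :=
  sSup {s | ∃ G : Fin r → SimpleGraph (Fin n), IsDecomp G ∧ ∑ i, β (G i) = s}

/-- Nordhaus–Gaddum sum lower bound `NGΣ↓_β(r;n)`. -/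
noncomputable def NGsumLow {n : ℕ} (β : SimpleGraph (Fin n) → ℕ) (r : ℕ) : ℕ :=
  sInf {s | ∃ G : Fin r → SimpleGraph (Fin n), IsDecomp G ∧ ∑ i, β (G i) = s}

/-- Non-degenerate Nordhaus–Gaddum sum lower bound `NGΣ↓ⁿ_β(r;n)`. -/
noncomputable def NGsumLowND {n : ℕ} (β : SimpleGraph (Fin n) → ℕ) (r : ℕ) : ℕ :=
  sInf {s | ∃ G : Fin r → SimpleGraph (Fin n), IsNDDecomp G ∧ ∑ i, β (G i) = s}

/-- Nordhaus–Gaddum product upper bound `NGΠ↑_β(r;n)`. -/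
noncomputable def NGprodUp {n : ℕ} (β : SimpleGraph (Fin n) → ℕ) (r : ℕ) : ℕ :=
  sSup {s | ∃ G : Fin r → SimpleGraph (Fin n), IsDecomp G ∧ ∏ i, β (G i) = s}

/-- Non-degenerate Nordhaus–Gaddum product upper bound `NGΠ↑ⁿ_β(r;n)`. -/
noncomputable def NGprodUpND {n : ℕ} (β : SimpleGraph (Fin n) → ℕ) (r : ℕ) : ℕ :=
  sSup {s | ∃ G : Fin r → SimpleGraph (Fin n), IsNDDecomp G ∧ ∏ i, β (G i) = s}

/-- Nordhaus–Gaddum product lower bound `NGΠ↓_β(r;n)`. -/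
noncomputable def NGprodLow {n : ℕ} (β : SimpleGraph (Fin n) → ℕ) (r : ℕ) : ℕ :=
  sInf {s | ∃ G : Fin r → SimpleGraph (Fin n), IsDecomp G ∧ ∏ i, β (G i) = s}

/-- Non-degenerate Nordhaus–Gaddum product lower bound `NGΠ↓ⁿ_β(r;n)`. -/
noncomputable def NGprodLowND {n : ℕ} (β : SimpleGraph (Fin n) → ℕ) (r : ℕ) : ℕ :=
  sInf {s | ∃ G : Fin r → SimpleGraph (Fin n), IsNDDecomp G ∧ ∏ i, β (G i) = s}

/-- The triangular root `t(r) = ⌈√(2r + 1/4) − 1/2⌉`. -/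
noncomputable def trt (r : ℕ) : ℕ := ⌈Real.sqrt (2 * (r : ℝ) + 1 / 4) - 1 / 2⌉₊

/-- `H` is a path together with isolated vertices: its edges are exactly those
of a path through some list of distinct vertices. -/
def IsPathGraph {n : ℕ} (H : SimpleGraph (Fin n)) : Prop :=
  ∃ (m : ℕ) (f : Fin (m + 1) ↪ Fin n), ∀ u v : Fin n,
    H.Adj u v ↔ ∃ a b : Fin (m + 1), (a : ℕ) + 1 = (b : ℕ) ∧
      ((u = f a ∧ v = f b) ∨ (u = f b ∧ v = f a))

end NG

namespace NG

/-- core linear k-tree -/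
def LK (n m : ℕ) : SimpleGraph (Fin n) where
  Adj i j := i ≠ j ∧ ((i : ℕ) < m ∨ (j : ℕ) < m ∨ (i : ℕ) + 1 = j ∨ (j : ℕ) + 1 = i)
  symm := ⟨by
    intro i j h
    refine ⟨h.1.symm, ?_⟩
    omega⟩
  loopless := ⟨by intro i h; exact h.1 rfl⟩

lemma LK_adj {n m : ℕ} (i j : Fin n) : (LK n m).Adj i j ↔
    (i : ℕ) ≠ j ∧ ((i : ℕ) < m ∨ (j : ℕ) < m ∨ (i : ℕ) + 1 = j ∨ (j : ℕ) + 1 = i) := by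
  simp [LK, Fin.ext_iff]

lemma card_aux {n m : ℕ} (j : Fin n) (hj : m + 1 ≤ (j : ℕ)) (S : Finset (Fin n))
    (hS : ∀ i : Fin n, i ∈ S ↔ ((i : ℕ) < m ∨ (i : ℕ) + 1 = j)) : S.card = m + 1 := by
  have h : S = insert (⟨(j : ℕ) - 1, by omega⟩ : Fin n)
      (Finset.univ.filter (fun i : Fin n => (i : ℕ) < m)) := by
    ext i
    simp only [hS, Finset.mem_insert, Finset.mem_filter, Finset.mem_univ, true_and, Fin.ext_iff]
    omega
  rw [h, Finset.card_insert_of_notMem]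
  · rw [Fin.card_filter_val_lt]; omega
  · simp; omega

lemma mem_back {n m : ℕ} (j : Fin n) (hj : m + 1 ≤ (j : ℕ)) (i : Fin n) :
    i ∈ backNbhd (LK n m) j ↔ ((i : ℕ) < m ∨ (i : ℕ) + 1 = j) := by
  simp only [backNbhd, Finset.mem_filter, Finset.mem_univ, true_and, LK_adj]
  omega

lemma LK_ktree {n m : ℕ} (h : m + 2 ≤ n) : IsKTreeOrd (m + 1) n (LK n m) := by
  refine ⟨by omega, by omega, ?_, ?_⟩
  · intro i j h1 h2
    rw [LK_adj]; omega
  · intro j hj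
    refine ⟨card_aux j (by omega) _ (mem_back j (by omega)), ?_⟩
    intro a ha b hb hab
    have ha' := (mem_back (m := m) j (by omega) a).1 (by simpa using ha)
    have hb' := (mem_back (m := m) j (by omega) b).1 (by simpa using hb)
    have : (a : ℕ) ≠ b := fun h => hab (Fin.ext h)
    rw [LK_adj]; omega

lemma LK_linear {n m : ℕ} (h : m + 2 ≤ n) : IsLinearKTreeOrd (m + 1) n (LK n m) := by
  refine ⟨LK_ktree h, fun i j hij hj => ?_⟩
  rw [mem_back j (by omega)]; omega

lemma LK_cat {n m : ℕ} (h : m + 2 ≤ n) : IsCaterpillarOrd (m + 1) n (LK n m) := by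
  refine ⟨LK_ktree h, fun i j hij hj a ha => ?_⟩
  rw [mem_back j (by omega)] at ha
  rw [Finset.mem_insert, mem_back i (by omega), Fin.ext_iff]; omega

lemma LK_two {n m : ℕ} (h : m + 2 ≤ n) : IsTwoSidedKTreeOrd (m + 1) n (LK n m) := by
  refine ⟨LK_ktree h, fun j hj => Or.inl ⟨⟨(j : ℕ) - 1, by omega⟩, ?_, ?_⟩⟩
  · rw [mem_back j (by omega)]; simp; omega
  · unfold stageDeg
    refine card_aux (⟨(j : ℕ) - 1, by omega⟩ : Fin n) (by simp; omega) _ (fun i => ?_)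
    simp only [Finset.mem_filter, Finset.mem_univ, true_and, LK_adj]
    omega

lemma ktree_lower {k N m : ℕ} {H : SimpleGraph (Fin N)} (hH : IsKTreeOrd k N H)
    (g : Fin (m + 2) → Fin N) (hg : ∀ a b, a ≠ b → H.Adj (g a) (g b)) : m + 1 ≤ k := by
  have hinj : Function.Injective g := by
    intro a b hab
    by_contra hne
    have := hg a b hne
    rw [hab] at this
    exact H.loopless.irrefl _ this
  set T : Finset (Fin N) := Finset.univ.image g with hT
  have hc : T.card = m + 2 := by
    rw [hT, Finset.card_image_of_injective _ hinj]; simp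
  have hne : T.Nonempty := by rw [← Finset.card_pos]; omega
  obtain ⟨j, hjT, hj⟩ := T.exists_max_image id hne
  by_cases hjk : k < (j : ℕ)
  · have h1 := (hH.2.2.2 j hjk).1
    have h2 : T.erase j ⊆ backNbhd H j := by
      intro i hi
      rw [Finset.mem_erase] at hi
      have h3 := hj i hi.2
      simp only [id] at h3
      have h4 : (i : ℕ) < j := lt_of_le_of_ne h3 (fun h => hi.1 (Fin.ext h))
      simp only [backNbhd, Finset.mem_filter, Finset.mem_univ, true_and]
      refine ⟨h4, ?_⟩
      obtain ⟨a, -, rfl⟩ := Finset.mem_image.1 hi.2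
      obtain ⟨b, -, rfl⟩ := Finset.mem_image.1 hjT
      exact hg a b (fun h => hi.1 (by rw [h]))
    have := Finset.card_le_card h2
    rw [Finset.card_erase_of_mem hjT] at this
    omega
  · have h2 : T ⊆ Finset.univ.filter (fun i : Fin N => (i : ℕ) < k + 1) := by
      intro i hi
      have h3 := hj i hi
      simp only [id] at h3
      have : (i : ℕ) ≤ j := h3
      simp; omega
    have := Finset.card_le_card h2
    rw [Fin.card_filter_val_lt] at this
    omega

lemma width_eq (P : ℕ → (N : ℕ) → SimpleGraph (Fin N) → Prop)
    (hP : ∀ k N H, P k N H → IsKTreeOrd k N H) {n m : ℕ}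
    (hL : P (m + 1) n (LK n m)) (G : SimpleGraph (Fin n))
    (f : Fin n ↪ Fin n) (hf : ∀ u v, G.Adj u v → (LK n m).Adj (f u) (f v))
    (g : Fin (m + 2) → Fin n) (hg : ∀ a b, a ≠ b → G.Adj (g a) (g b)) :
    widthParam P n G = m + 1 := by
  have hne : G ≠ ⊥ := by
    rintro rfl
    have := hg 0 1 (by simp)
    simp at this
  unfold widthParam
  rw [if_neg hne]
  apply IsLeast.csInf_eq
  refine ⟨⟨n, _, f, hL, hf⟩, ?_⟩
  rintro k ⟨N, H, f', hPk, hf'⟩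
  exact ktree_lower (hP _ _ _ hPk) (fun a => f' (g a)) (fun a b hab => hf' _ _ (hg a b hab))

lemma width_all {n m : ℕ} (h : m + 2 ≤ n) (G : SimpleGraph (Fin n))
    (f : Fin n ↪ Fin n) (hf : ∀ u v, G.Adj u v → (LK n m).Adj (f u) (f v))
    (g : Fin (m + 2) → Fin n) (hg : ∀ a b, a ≠ b → G.Adj (g a) (g b)) :
    treewidth n G = m + 1 ∧ la n G = m + 1 ∧ pw n G = m + 1 ∧ ppw n G = m + 1 :=
  ⟨width_eq _ (fun _ _ _ h => h) (LK_ktree h) G f hf g hg,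
   width_eq _ (fun _ _ _ h => h.1) (LK_two h) G f hf g hg,
   width_eq _ (fun _ _ _ h => h.1) (LK_cat h) G f hf g hg,
   width_eq _ (fun _ _ _ h => h.1) (LK_linear h) G f hf g hg⟩

end NG

namespace NG

open Matrix in
lemma neg_count {n : ℕ} (A : Matrix (Fin n) (Fin n) ℝ) (hA : A.IsHermitian) (l : Fin n → ℝ)
    (h : ∀ x : Fin n → ℝ, l ⬝ᵥ x = 0 → 0 ≤ x ⬝ᵥ A *ᵥ x)
    (hx : ∃ x : Fin n → ℝ, x ⬝ᵥ A *ᵥ x < 0) :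
    (Finset.univ.filter (fun i => hA.eigenvalues i < 0)).card = 1 := by
  apply le_antisymm
  · rw [Finset.card_le_one]
    intro i hi j hj
    by_contra hij
    simp only [Finset.mem_filter, Finset.mem_univ, true_and] at hi hj
    have key : ∀ i j, (hA.eigenvectorBasis i : Fin n → ℝ) ⬝ᵥ (hA.eigenvectorBasis j : Fin n → ℝ)
        = if i = j then 1 else 0 := by
      intro i j
      have := orthonormal_iff_ite.1 hA.eigenvectorBasis.orthonormal j i
      rw [EuclideanSpace.inner_eq_star_dotProduct] at this
      simp only [star_trivial] at this
      rw [this]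
      simp [eq_comm]
    set u : Fin n → ℝ := ⇑(hA.eigenvectorBasis i) with hu
    set v : Fin n → ℝ := ⇑(hA.eigenvectorBasis j) with hv
    have hAu : A *ᵥ u = hA.eigenvalues i • u := hA.mulVec_eigenvectorBasis i
    have hAv : A *ᵥ v = hA.eigenvalues j • v := hA.mulVec_eigenvectorBasis j
    have huu : u ⬝ᵥ u = 1 := by simpa using key i i
    have hvv : v ⬝ᵥ v = 1 := by simpa using key j j
    have huv : u ⬝ᵥ v = 0 := by simpa [hij] using key i j
    have hvu : v ⬝ᵥ u = 0 := by rw [dotProduct_comm]; exact huv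
    by_cases h0 : l ⬝ᵥ u = 0
    · have := h u h0
      rw [hAu, dotProduct_smul, huu] at this
      simp at this; linarith
    · have := h ((l ⬝ᵥ v) • u + (-(l ⬝ᵥ u)) • v) (by
        simp only [dotProduct_add, dotProduct_smul, smul_eq_mul]; ring)
      simp only [mulVec_add, mulVec_smul, hAu, hAv, dotProduct_add, dotProduct_smul, add_dotProduct,
        smul_dotProduct, huu, hvv, huv, hvu, smul_eq_mul] at this
      have h1 : 0 < (l ⬝ᵥ u) ^ 2 := by positivity
      nlinarith [sq_nonneg (l ⬝ᵥ v)]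
  · rw [Nat.one_le_iff_ne_zero, Finset.card_ne_zero]
    by_contra hne
    rw [Finset.not_nonempty_iff_eq_empty, Finset.filter_eq_empty_iff] at hne
    have hp : A.PosSemidef := hA.posSemidef_iff_eigenvalues_nonneg.2 (fun i => by
      have := hne (Finset.mem_univ i)
      simpa using this)
    obtain ⟨x, hx⟩ := hx
    have := hp.dotProduct_mulVec_nonneg x
    simp only [star_trivial] at this
    linarith

lemma finrank_le_coords {n k : ℕ} (W : Submodule ℝ (Fin n → ℝ)) (g : Fin k → Fin n)
    (h : ∀ x ∈ W, (∀ a, x (g a) = 0) → x = 0) : Module.finrank ℝ W ≤ k := by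
  have hinj : Function.Injective ((LinearMap.funLeft ℝ ℝ g).comp W.subtype) := by
    rw [← LinearMap.ker_eq_bot, LinearMap.ker_eq_bot']
    rintro ⟨x, hx⟩ h0
    have : x = 0 := h x hx (fun a => by simpa [LinearMap.funLeft] using congrFun h0 a)
    simpa using this
  simpa using LinearMap.finrank_le_finrank_of_injective hinj

open Matrix in
lemma nullity_le {n k : ℕ} (A : Matrix (Fin n) (Fin n) ℝ) (g : Fin k → Fin n)
    (h : ∀ x, A *ᵥ x = 0 → (∀ a, x (g a) = 0) → x = 0) : nullity A ≤ k :=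
  finrank_le_coords _ g (fun x hx => h x (by simpa using hx))

open Matrix in
lemma nullity_ge {n N : ℕ} (A : Matrix (Fin n) (Fin n) ℝ) (B : ℕ → Fin n → ℝ)
    (h : ∀ x, (∀ k < N, B k ⬝ᵥ x = 0) → A *ᵥ x = 0) : n - N ≤ nullity A := by
  let M : Matrix (Fin N) (Fin n) ℝ := Matrix.of (fun k => B k)
  have h1 : LinearMap.ker (Matrix.toLin' M) ≤ LinearMap.ker (Matrix.toLin' A) := by
    intro x hx
    have hx' : M *ᵥ x = 0 := by simpa using hx
    have : A *ᵥ x = 0 := h x (fun k hk => congrFun hx' ⟨k, hk⟩)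
    simpa using this
  have h2 := Submodule.finrank_mono h1
  have h3 := LinearMap.finrank_range_add_finrank_ker (Matrix.toLin' M)
  have h4 : Module.finrank ℝ (LinearMap.range (Matrix.toLin' M)) ≤ N := by
    simpa using Submodule.finrank_le (LinearMap.range (Matrix.toLin' M))
  have h5 : Module.finrank ℝ (Fin n → ℝ) = n := by simp
  unfold nullity
  omega

open Matrix in
lemma force {n : ℕ} {A : Matrix (Fin n) (Fin n) ℝ} {G : SimpleGraph (Fin n)}
    (hA : DescribesGraph A G) {x : Fin n → ℝ} (hx : A *ᵥ x = 0) (i w : Fin n)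
    (hi : x i = 0) (hv : ∀ v, v ≠ w → G.Adj i v → x v = 0) (hw : G.Adj i w) : x w = 0 := by
  have h1 : ∑ v, A i v * x v = 0 := congrFun hx i
  rw [Finset.sum_eq_single w] at h1
  · rcases mul_eq_zero.1 h1 with h | h
    · exact absurd h ((hA.2 i w hw.ne).2 hw)
    · exact h
  · intro v _ hvw
    by_cases hvi : i = v
    · rw [← hvi, hi, mul_zero]
    · by_cases hadj : G.Adj i v
      · rw [hv v hvw hadj, mul_zero]
      · have : A i v = 0 := by
          by_contra hne
          exact hadj ((hA.2 i v hvi).1 hne)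
        rw [this, zero_mul]
  · simp

/-- common structure : path on positions `< s` -/
structure PathCore {n : ℕ} (s : ℕ) (e : Fin n ≃ Fin n) (G : SimpleGraph (Fin n)) : Prop where
  hs : 4 ≤ s
  hn : s ≤ n
  adj : ∀ u v, (e u : ℕ) < s → (e v : ℕ) < s →
    (G.Adj u v ↔ ((e u : ℕ) + 1 = e v ∨ (e v : ℕ) + 1 = e u))

open Matrix in
lemma force_path {n s : ℕ} {e : Fin n ≃ Fin n} {G : SimpleGraph (Fin n)} (hG : PathCore s e G)
    {A : Matrix (Fin n) (Fin n) ℝ}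
    (hA : DescribesGraph A G) {x : Fin n → ℝ} (hx : A *ᵥ x = 0)
    (hout : ∀ v, s ≤ (e v : ℕ) → x v = 0) (j : Fin n) (hj : x j = 0)
    (hjs : (e j : ℕ) < s)
    (hnb : (∀ v, G.Adj j v → x v = 0) ∨ (e j : ℕ) = 0) : x = 0 := by
  have hn := hG.hn
  have step : ∀ i w : Fin n, (e i : ℕ) < s → (e w : ℕ) < s → G.Adj i w → x i = 0 →
      (∀ v, v ≠ w → (e v : ℕ) < s → G.Adj i v → x v = 0) → x w = 0 := by
    intro i w hi hw hiw hxi hv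
    refine force hA hx i w hxi (fun v hvw hadj => ?_) hiw
    by_cases h : (e v : ℕ) < s
    · exact hv v hvw h hadj
    · exact hout v (by omega)
  have hnb' : ∀ v, (e v : ℕ) < s → G.Adj j v → x v = 0 := by
    intro v hvs hv
    rcases hnb with h | h
    · exact h v hv
    · refine step j v hjs hvs hv hj (fun w hwv hws hjw => ?_)
      rw [hG.adj j w hjs hws] at hjw
      rw [hG.adj j v hjs hvs] at hv
      exact absurd (e.injective (Fin.ext (by omega))) hwv
  have up : ∀ d : ℕ, ∀ w : Fin n, (e w : ℕ) < s → (e w : ℕ) = e j + d → x w = 0 := by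
    intro d
    induction d using Nat.strong_induction_on with
    | _ d ih =>
      intro w hws hw
      rcases d with _ | _ | d
      · have : w = j := e.injective (Fin.ext (by omega))
        rw [this, hj]
      · exact hnb' w hws ((hG.adj _ _ hjs hws).2 (by omega))
      · obtain ⟨i, hi⟩ : ∃ i, e i = ⟨(e j : ℕ) + d + 1, by omega⟩ := ⟨_, e.apply_symm_apply _⟩
        have hi' : (e i : ℕ) = e j + d + 1 := by rw [hi]
        refine step i w (by omega) hws ((hG.adj _ _ (by omega) hws).2 (by omega))
          (ih (d + 1) (by omega) i (by omega) (by omega)) (fun v hvw hvs hiv => ?_)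
        rw [hG.adj _ _ (by omega) hvs] at hiv
        have : (e v : ℕ) ≠ e w := fun h => hvw (e.injective (Fin.ext h))
        exact ih d (by omega) v hvs (by omega)
  have down : ∀ d : ℕ, ∀ w : Fin n, (e w : ℕ) < s → (e w : ℕ) + d = e j → x w = 0 := by
    intro d
    induction d using Nat.strong_induction_on with
    | _ d ih =>
      intro w hws hw
      rcases d with _ | _ | d
      · have : w = j := e.injective (Fin.ext (by omega))
        rw [this, hj]
      · exact hnb' w hws ((hG.adj _ _ hjs hws).2 (by omega))
      · obtain ⟨i, hi⟩ : ∃ i, e i = ⟨(e w : ℕ) + 1, by omega⟩ := ⟨_, e.apply_symm_apply _⟩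
        have hi' : (e i : ℕ) = e w + 1 := by rw [hi]
        refine step i w (by omega) hws ((hG.adj _ _ (by omega) hws).2 (by omega))
          (ih (d + 1) (by omega) i (by omega) (by omega)) (fun v hvw hvs hiv => ?_)
        rw [hG.adj _ _ (by omega) hvs] at hiv
        have : (e v : ℕ) ≠ e w := fun h => hvw (e.injective (Fin.ext h))
        exact ih d (by omega) v hvs (by omega)
  funext w
  by_cases hws : (e w : ℕ) < s
  · rcases le_total (e w : ℕ) (e j) with h | h
    · exact down (e j - e w) w hws (by omega)
    · exact up (e w - e j) w hws (by omega)
  · exact hout w (by omega)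

open Matrix in
lemma sap_core {n s : ℕ} {e : Fin n ≃ Fin n} {G : SimpleGraph (Fin n)} (hG : PathCore s e G)
    {A : Matrix (Fin n) (Fin n) ℝ} (hA : DescribesGraph A G)
    (X : Matrix (Fin n) (Fin n) ℝ) (hX : X.IsSymm) (hAX : A * X = 0)
    (h1 : ∀ i j, A i j * X i j = 0) (h2 : ∀ i, X i i = 0)
    (hout : ∀ i j, s ≤ (e i : ℕ) → X i j = 0) : X = 0 := by
  have key : ∀ j, (fun i => X i j) = 0 := by
    intro j
    by_cases hj : (e j : ℕ) < s
    · refine force_path hG hA (x := fun i => X i j) ?_ (fun v hv => hout v j hv) j (h2 j) hj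
        (Or.inl (fun v hv => ?_))
      · funext i
        exact congrFun (congrFun hAX i) j
      · have h3 := h1 v j
        exact (mul_eq_zero.1 h3).resolve_left ((hA.2 v j hv.symm.ne).2 hv.symm)
    · funext i
      show X i j = 0
      rw [← hX.apply]
      exact hout j i (by omega)
  ext i j
  exact congrFun (key j) i

/-- path joined with a clique -/
structure JoinG {n : ℕ} (s : ℕ) (e : Fin n ≃ Fin n) (G : SimpleGraph (Fin n)) : Prop where
  core : PathCore s e G
  out : ∀ u v, u ≠ v → s ≤ (e u : ℕ) → G.Adj u v

/-- path with isolated vertices -/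
structure IsoG {n : ℕ} (s : ℕ) (e : Fin n ≃ Fin n) (G : SimpleGraph (Fin n)) : Prop where
  core : PathCore s e G
  out : ∀ u v, s ≤ (e u : ℕ) → ¬ G.Adj u v

lemma join_sap {n s : ℕ} {e : Fin n ≃ Fin n} {G : SimpleGraph (Fin n)} (hG : JoinG s e G)
    {A : Matrix (Fin n) (Fin n) ℝ} (hA : DescribesGraph A G) : StrongArnold A := by
  intro X hX hAX h1 h2
  refine sap_core hG.core hA X hX hAX h1 h2 (fun i j hi => ?_)
  by_cases hij : i = j
  · rw [← hij]; exact h2 i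
  · exact (mul_eq_zero.1 (h1 i j)).resolve_left ((hA.2 i j hij).2 (hG.out i j hij hi))

open Matrix in
lemma iso_row {n s : ℕ} {e : Fin n ≃ Fin n} {G : SimpleGraph (Fin n)} (hG : IsoG s e G)
    {A : Matrix (Fin n) (Fin n) ℝ} (hA : DescribesGraph A G) (i : Fin n) (hi : s ≤ (e i : ℕ))
    (x : Fin n → ℝ) : (A *ᵥ x) i = A i i * x i := by
  show ∑ v, A i v * x v = _
  rw [Finset.sum_eq_single i]
  · intro v _ hv
    have : A i v = 0 := by
      by_contra hne
      exact hG.out i v hi ((hA.2 i v hv.symm).1 hne)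
    rw [this, zero_mul]
  · simp

lemma iso_sap {n s : ℕ} {e : Fin n ≃ Fin n} {G : SimpleGraph (Fin n)} (hG : IsoG s e G)
    {A : Matrix (Fin n) (Fin n) ℝ} (hA : DescribesGraph A G)
    (hd : ∀ i, s ≤ (e i : ℕ) → A i i ≠ 0) : StrongArnold A := by
  intro X hX hAX h1 h2
  refine sap_core hG.core hA X hX hAX h1 h2 (fun i j hi => ?_)
  have h3 := iso_row hG hA i hi (fun i => X i j)
  have h4 : (A.mulVec (fun i => X i j)) i = 0 := congrFun (congrFun hAX i) j
  rw [h4] at h3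
  exact (mul_eq_zero.1 h3.symm).resolve_left (hd i hi)

open Matrix in
lemma join_nullity {n s : ℕ} {e : Fin n ≃ Fin n} {G : SimpleGraph (Fin n)} (hG : JoinG s e G)
    {A : Matrix (Fin n) (Fin n) ℝ} (hA : DescribesGraph A G) : nullity A ≤ n - s + 1 := by
  have hn := hG.core.hn
  have hs := hG.core.hs
  let g : Fin (n - s + 1) → Fin n := fun a =>
    e.symm ⟨if (a : ℕ) = 0 then 0 else (a : ℕ) - 1 + s, by split_ifs <;> omega⟩
  refine nullity_le A g (fun x hx h0 => ?_)
  have hz : x (e.symm ⟨0, by omega⟩) = 0 := by simpa [g] using h0 0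
  refine force_path hG.core hA hx (fun v hv => ?_) _ hz (by simp; omega) (Or.inr (by simp))
  have := h0 ⟨(e v : ℕ) - s + 1, by omega⟩
  have h2 : g ⟨(e v : ℕ) - s + 1, by omega⟩ = v := by
    simp only [g]
    rw [Equiv.symm_apply_eq, Fin.ext_iff]
    simp; omega
  rwa [h2] at this

open Matrix in
lemma iso_nullity {n s : ℕ} {e : Fin n ≃ Fin n} {G : SimpleGraph (Fin n)} (hG : IsoG s e G)
    {A : Matrix (Fin n) (Fin n) ℝ} (hA : DescribesGraph A G) (hS : StrongArnold A) :
    nullity A ≤ 1 := by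
  have hn := hG.core.hn
  have hs := hG.core.hs
  by_cases hd : ∀ i, s ≤ (e i : ℕ) → A i i ≠ 0
  · refine nullity_le A (fun _ => e.symm ⟨0, by omega⟩) (fun x hx h0 => ?_)
    refine force_path hG.core hA hx (fun v hv => ?_) _ (h0 0) (by simp; omega) (Or.inr (by simp))
    have h3 := iso_row hG hA v hv x
    rw [hx] at h3
    exact (mul_eq_zero.1 h3.symm).resolve_left (hd v hv)
  · push Not at hd
    obtain ⟨i, hi, hii⟩ := hd
    refine nullity_le A (fun _ => i) (fun x hx h0 => ?_)
    have hxi : x i = 0 := h0 0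
    have hcol : ∀ k, A k i = 0 := by
      intro k
      by_cases hk : k = i
      · rw [hk, hii]
      · by_contra hne
        exact hG.out i k hi ((hA.2 k i hk).1 hne).symm
    have hrow : ∀ k, A i k = 0 := fun k => by rw [← hA.1.apply]; exact hcol k
    let y : Fin n → ℝ := Pi.single i 1
    have hy : A *ᵥ y = 0 := by
      funext k
      simp [y, hcol]
    have hX := hS (vecMulVec x y + vecMulVec y x) ?_ ?_ ?_ ?_
    · funext k
      have := congrFun (congrFun hX k) i
      simpa [vecMulVec_apply, y, hxi] using this
    · ext a b
      simp [vecMulVec_apply]; ring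
    · rw [Matrix.mul_add, Matrix.mul_vecMulVec, Matrix.mul_vecMulVec, hx, hy]
      simp
    · intro a b
      by_cases ha : a = i
      · rw [ha, hrow, zero_mul]
      · by_cases hb : b = i
        · rw [hb, hcol, zero_mul]
        · simp [vecMulVec_apply, y, ha, hb]
    · intro a
      by_cases ha : a = i
      · rw [ha]; simp [vecMulVec_apply, hxi]
      · simp [vecMulVec_apply, y, ha]

end NG

namespace NG

/-- Gram type matrix -/
noncomputable def gram {n : ℕ} (N : ℕ) (B : ℕ → Fin n → ℝ) : Matrix (Fin n) (Fin n) ℝ :=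
  Matrix.of fun u v => ∑ k ∈ Finset.range N, B k u * B k v

/-- Lorentzian Gram type matrix -/
noncomputable def lor {n : ℕ} (N : ℕ) (B : ℕ → Fin n → ℝ) : Matrix (Fin n) (Fin n) ℝ :=
  Matrix.of fun u v => -(B 0 u * B 1 v + B 1 u * B 0 v) + ∑ k ∈ Finset.Ico 2 N, B k u * B k v

open Matrix in
lemma gram_mulVec {n N : ℕ} (B : ℕ → Fin n → ℝ) (x : Fin n → ℝ) :
    gram N B *ᵥ x = ∑ k ∈ Finset.range N, (B k ⬝ᵥ x) • B k := by
  funext u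
  simp only [gram, mulVec, dotProduct, of_apply, Finset.sum_apply, Pi.smul_apply, smul_eq_mul,
    Finset.sum_mul]
  rw [Finset.sum_comm]
  refine Finset.sum_congr rfl fun k _ => Finset.sum_congr rfl fun v _ => by ring

open Matrix in
lemma lor_mulVec {n N : ℕ} (B : ℕ → Fin n → ℝ) (x : Fin n → ℝ) :
    lor N B *ᵥ x = -((B 1 ⬝ᵥ x) • B 0 + (B 0 ⬝ᵥ x) • B 1) +
      ∑ k ∈ Finset.Ico 2 N, (B k ⬝ᵥ x) • B k := by
  funext u
  simp only [lor, mulVec, dotProduct, of_apply, Finset.sum_apply, Pi.smul_apply, smul_eq_mul,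
    Finset.sum_mul, Pi.add_apply, Pi.neg_apply, add_mul, Finset.sum_add_distrib, neg_add]
  congr 1
  · rw [← Finset.sum_neg_distrib, ← Finset.sum_neg_distrib]
    congr 1 <;> exact Finset.sum_congr rfl fun v _ => by ring
  · rw [Finset.sum_comm]
    refine Finset.sum_congr rfl fun k _ => Finset.sum_congr rfl fun v _ => by ring

open Matrix in
lemma gram_psd {n N : ℕ} (B : ℕ → Fin n → ℝ) : (gram N B).PosSemidef := by
  refine .of_dotProduct_mulVec_nonneg ?_ (fun x => ?_)
  · ext u v
    simp [gram, mul_comm]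
  · rw [gram_mulVec, star_trivial, dotProduct_sum]
    refine Finset.sum_nonneg fun k _ => ?_
    rw [dotProduct_smul, dotProduct_comm, smul_eq_mul]
    exact mul_self_nonneg _

lemma gram_nullity {n N : ℕ} (B : ℕ → Fin n → ℝ) : n - N ≤ nullity (gram N B) := by
  refine nullity_ge _ B (fun x hx => ?_)
  rw [gram_mulVec]
  refine Finset.sum_eq_zero fun k hk => ?_
  rw [hx k (Finset.mem_range.1 hk), zero_smul]

lemma lor_nullity {n N : ℕ} (hN : 2 ≤ N) (B : ℕ → Fin n → ℝ) : n - N ≤ nullity (lor N B) := by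
  refine nullity_ge _ B (fun x hx => ?_)
  rw [lor_mulVec, hx 0 (by omega), hx 1 (by omega), Finset.sum_eq_zero]
  · simp
  intro k hk
  rw [hx k (Finset.mem_Ico.1 hk).2, zero_smul]

lemma lor_symm {n N : ℕ} (B : ℕ → Fin n → ℝ) : (lor N B).IsSymm := by
  ext u v
  simp only [lor, Matrix.transpose_apply, Matrix.of_apply]
  congr 1
  · ring
  · exact Finset.sum_congr rfl fun k _ => by ring

lemma lor_herm {n N : ℕ} (B : ℕ → Fin n → ℝ) : (lor N B).IsHermitian := by
  have := lor_symm (N := N) B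
  unfold Matrix.IsHermitian
  rw [Matrix.conjTranspose_eq_transpose_of_trivial]
  exact this

open Matrix in
lemma lor_count {n N : ℕ} (B : ℕ → Fin n → ℝ) (p q : Fin n) (hpp : lor N B p p = 0)
    (hqq : lor N B q q = 0) (hpq : lor N B p q < 0) :
    (Finset.univ.filter (fun i => (lor_herm (N := N) B).eigenvalues i < 0)).card = 1 := by
  refine neg_count _ _ (B 0) (fun x hx => ?_) ⟨Pi.single p 1 + Pi.single q 1, ?_⟩
  · rw [lor_mulVec, hx, dotProduct_add, dotProduct_neg, dotProduct_add, dotProduct_smul,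
      dotProduct_comm x (B 0), hx, dotProduct_sum]
    simp only [smul_zero, zero_smul, dotProduct_zero, add_zero, neg_zero, zero_add]
    refine Finset.sum_nonneg fun k _ => ?_
    rw [dotProduct_smul, dotProduct_comm, smul_eq_mul]
    exact mul_self_nonneg _
  · have hqp : lor N B q p = lor N B p q := (lor_symm B).apply _ _
    simp only [mulVec_add, dotProduct_add, add_dotProduct, single_one_dotProduct, mulVec_single_one,
      col_apply, hpp, hqq, hqp]
    linarith

lemma gram_ind {n N : ℕ} (R : ℕ → Fin n → Prop) (u v : Fin n) :
    gram N (fun k u => if R k u then 1 else 0) u v ≠ 0 ↔ ∃ k < N, R k u ∧ R k v := by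
  simp only [gram, Matrix.of_apply]
  rw [Ne, Finset.sum_eq_zero_iff_of_nonneg]
  · push Not
    constructor
    · rintro ⟨k, hk, h⟩
      refine ⟨k, Finset.mem_range.1 hk, ?_⟩
      by_contra hc
      apply h
      by_cases h1 : R k u <;> by_cases h2 : R k v <;> simp_all
    · rintro ⟨k, hk, h1, h2⟩
      exact ⟨k, Finset.mem_range.2 hk, by simp [h1, h2]⟩
  · intro k _
    split_ifs <;> simp

lemma params_eq {n K : ℕ} {G : SimpleGraph (Fin n)}
    (hup : ∀ A : Matrix (Fin n) (Fin n) ℝ, DescribesGraph A G → StrongArnold A → nullity A ≤ K)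
    (A : Matrix (Fin n) (Fin n) ℝ) (hA : DescribesGraph A G) (hAS : StrongArnold A)
    (hAp : A.PosSemidef) (hAn : K ≤ nullity A)
    (C : Matrix (Fin n) (Fin n) ℝ) (hC : DescribesGraph C G) (hCS : StrongArnold C)
    (hCh : C.IsHermitian)
    (hCe : (Finset.univ.filter (fun i => hCh.eigenvalues i < 0)).card = 1)
    (hCm : ∀ i j : Fin n, i ≠ j → C i j ≤ 0) (hCn : K ≤ nullity C) :
    muParam n G = K ∧ nuParam n G = K ∧ xiParam n G = K := by
  have hA' := le_antisymm (hup A hA hAS) hAn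
  have hC' := le_antisymm (hup C hC hCS) hCn
  refine ⟨IsGreatest.csSup_eq ⟨⟨C, hCh, hC, hCS, hCe, hCm, hC'⟩, ?_⟩,
    IsGreatest.csSup_eq ⟨⟨A, hA, hAp, hAS, hA'⟩, ?_⟩,
    IsGreatest.csSup_eq ⟨⟨A, hA, hAS, hA'⟩, ?_⟩⟩
  · rintro m ⟨A, _, h1, h2, _, _, rfl⟩
    exact hup A h1 h2
  · rintro m ⟨A, h1, _, h2, rfl⟩
    exact hup A h1 h2
  · rintro m ⟨A, h1, h2, rfl⟩
    exact hup A h1 h2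

lemma gram_desc {n N : ℕ} {G : SimpleGraph (Fin n)} (R : ℕ → Fin n → Prop)
    (h : ∀ u v, u ≠ v → ((∃ k < N, R k u ∧ R k v) ↔ G.Adj u v)) :
    DescribesGraph (gram N (fun k u => if R k u then 1 else 0)) G := by
  refine ⟨?_, fun u v huv => ?_⟩
  · have := (gram_psd (N := N) (fun k (u : Fin n) => if R k u then (1 : ℝ) else 0)).1
    unfold Matrix.IsHermitian at this
    rw [Matrix.conjTranspose_eq_transpose_of_trivial] at this
    exact this
  · rw [gram_ind, h u v huv]

lemma lor_desc {n N : ℕ} {G : SimpleGraph (Fin n)} (B : ℕ → Fin n → ℝ)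
    (h1 : ∀ u v, G.Adj u v → lor N B u v < 0)
    (h2 : ∀ u v, u ≠ v → ¬ G.Adj u v → lor N B u v = 0) :
    DescribesGraph (lor N B) G ∧ ∀ u v, u ≠ v → lor N B u v ≤ 0 := by
  refine ⟨⟨lor_symm B, fun u v huv => ⟨fun h => ?_, fun h => (h1 u v h).ne⟩⟩, fun u v huv => ?_⟩
  · by_contra hc
    exact h (h2 u v huv hc)
  · by_cases hc : G.Adj u v
    · exact (h1 u v hc).le
    · exact (h2 u v huv hc).le

/-- iso rows -/
def bI (s k i : ℕ) : ℝ :=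
  if k = 0 then (if i = 1 then 1 else 0) else
  if k = 1 then (if i = 0 ∨ i = 2 then 1 else 0) else
  if i = k ∧ k + 1 < s then 1 else if i = k + 1 then -1 else 0

/-- coefficients -/
noncomputable def cc (s k : ℕ) : ℝ := (s : ℝ) - 1 - k

/-- join rows -/
noncomputable def bJ (s k i : ℕ) : ℝ :=
  if i < s then bI s k i else
  if k = 0 then s else if k = 1 then 1 + ∑ k ∈ Finset.Ico 2 (s - 1), cc s k * cc s k else cc s k

lemma bI_path {s N i j : ℕ} (hs : 4 ≤ s) (hN : s - 1 ≤ N) (hi : i < s) (hj : j < s)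
    (hij : i + 1 = j ∨ j + 1 = i) :
    -(bI s 0 i * bI s 1 j + bI s 1 i * bI s 0 j) +
      ∑ k ∈ Finset.Ico 2 N, bI s k i * bI s k j < 0 := by
  have hle : ∀ k ∈ Finset.Ico 2 N, bI s k i * bI s k j ≤ 0 := by
    intro k hk
    rw [Finset.mem_Ico] at hk
    unfold bI
    simp only [if_neg (show ¬ k = 0 by omega), if_neg (show ¬ k = 1 by omega)]
    split_ifs <;> first | omega | norm_num
  by_cases h : i ≤ 1 ∨ j ≤ 1
  · have h1 : -(bI s 0 i * bI s 1 j + bI s 1 i * bI s 0 j) < 0 := by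
      unfold bI
      simp only [if_true, if_false, one_ne_zero]
      split_ifs <;> first | omega | norm_num
    have := Finset.sum_nonpos hle
    linarith
  · have h1 : -(bI s 0 i * bI s 1 j + bI s 1 i * bI s 0 j) = 0 := by
      unfold bI
      simp only [if_true, if_false, one_ne_zero]
      split_ifs <;> first | omega | norm_num
    rw [h1, zero_add]
    refine Finset.sum_neg' hle ⟨min i j, ?_, ?_⟩
    · rw [Finset.mem_Ico]; omega
    · unfold bI
      simp only [if_neg (show ¬ min i j = 0 by omega), if_neg (show ¬ min i j = 1 by omega)]
      split_ifs <;> first | omega | norm_num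

lemma bI_zero {s N i j : ℕ} (hs : 4 ≤ s) (hne : i ≠ j)
    (hij : ¬ (i < s ∧ j < s ∧ (i + 1 = j ∨ j + 1 = i))) :
    -(bI s 0 i * bI s 1 j + bI s 1 i * bI s 0 j) +
      ∑ k ∈ Finset.Ico 2 N, bI s k i * bI s k j = 0 := by
  rw [Finset.sum_eq_zero]
  · unfold bI
    simp only [if_true, if_false, one_ne_zero]
    split_ifs <;> first | omega | norm_num
  · intro k hk
    rw [Finset.mem_Ico] at hk
    unfold bI
    simp only [if_neg (show ¬ k = 0 by omega), if_neg (show ¬ k = 1 by omega)]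
    split_ifs <;> first | omega | norm_num

lemma bI_diag {s N i : ℕ} (hi : i < 2) :
    -(bI s 0 i * bI s 1 i + bI s 1 i * bI s 0 i) +
      ∑ k ∈ Finset.Ico 2 N, bI s k i * bI s k i = 0 := by
  rw [Finset.sum_eq_zero]
  · unfold bI
    simp only [if_true, if_false, one_ne_zero]
    split_ifs <;> first | omega | norm_num
  · intro k hk
    rw [Finset.mem_Ico] at hk
    unfold bI
    rw [if_neg (by omega), if_neg (by omega)]
    split_ifs <;> first | omega | norm_num

lemma bI_sum {s i : ℕ} (hs : 4 ≤ s) (hi : i < s) :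
    ∑ k ∈ Finset.Ico 2 (s - 1), bI s k i * cc s k =
      (if 2 ≤ i then cc s i else 0) - (if 3 ≤ i then cc s (i - 1) else 0) := by
  have h1 : ∀ k ∈ Finset.Ico 2 (s - 1), bI s k i * cc s k =
      (if i = k then cc s k else 0) - (if i - 1 = k then if 3 ≤ i then cc s k else 0 else 0) := by
    intro k hk
    rw [Finset.mem_Ico] at hk
    unfold bI
    rw [if_neg (by omega), if_neg (by omega)]
    split_ifs <;> first | omega | simp
  rw [Finset.sum_congr rfl h1, Finset.sum_sub_distrib, Finset.sum_ite_eq, Finset.sum_ite_eq]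
  simp only [Finset.mem_Ico]
  congr 1
  · by_cases h : i = s - 1
    · have : cc s i = 0 := by
        unfold cc
        rw [h]; push_cast [Nat.cast_sub (show 1 ≤ s by omega)]; ring
      simp [this]
    · split_ifs <;> first | omega | rfl
  · split_ifs <;> first | omega | rfl

lemma bJ_mixed {s i j : ℕ} (hs : 4 ≤ s) (hi : i < s) (hj : s ≤ j) :
    -(bJ s 0 i * bJ s 1 j + bJ s 1 i * bJ s 0 j) +
      ∑ k ∈ Finset.Ico 2 (s - 1), bJ s k i * bJ s k j < 0 := by
  have h1 : ∀ k ∈ Finset.Ico 2 (s - 1), bJ s k i * bJ s k j = bI s k i * cc s k := by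
    intro k hk
    rw [Finset.mem_Ico] at hk
    unfold bJ
    rw [if_pos hi, if_neg (by omega), if_neg (by omega), if_neg (by omega)]
  rw [Finset.sum_congr rfl h1, bI_sum hs hi]
  have hp : 0 ≤ ∑ k ∈ Finset.Ico 2 (s - 1), cc s k * cc s k :=
    Finset.sum_nonneg fun k _ => mul_self_nonneg _
  have hs' : (4 : ℝ) ≤ s := by exact_mod_cast hs
  unfold bJ
  simp only [if_pos hi, if_neg (show ¬ j < s by omega), if_true, one_ne_zero, if_false]
  generalize ∑ k ∈ Finset.Ico 2 (s - 1), cc s k * cc s k = S at *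
  rcases i with _ | _ | _ | i
  · simp [bI]; omega
  · simp [bI]; linarith
  · simp [bI, cc]; linarith
  · simp [bI, cc]

lemma bJ_out {s i j : ℕ} (hs : 4 ≤ s) (hi : s ≤ i) (hj : s ≤ j) :
    -(bJ s 0 i * bJ s 1 j + bJ s 1 i * bJ s 0 j) +
      ∑ k ∈ Finset.Ico 2 (s - 1), bJ s k i * bJ s k j < 0 := by
  have h1 : ∀ k ∈ Finset.Ico 2 (s - 1), bJ s k i * bJ s k j = cc s k * cc s k := by
    intro k hk
    rw [Finset.mem_Ico] at hk
    unfold bJ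
    rw [if_neg (by omega), if_neg (by omega), if_neg (by omega), if_neg (by omega)]
  rw [Finset.sum_congr rfl h1]
  have hp : 0 ≤ ∑ k ∈ Finset.Ico 2 (s - 1), cc s k * cc s k :=
    Finset.sum_nonneg fun k _ => mul_self_nonneg _
  have hs' : (4 : ℝ) ≤ s := by exact_mod_cast hs
  unfold bJ
  simp only [if_neg (show ¬ i < s by omega), if_neg (show ¬ j < s by omega), if_true, one_ne_zero,
    if_false]
  generalize ∑ k ∈ Finset.Ico 2 (s - 1), cc s k * cc s k = S at *
  nlinarith

lemma bJ_lt {s k i : ℕ} (hi : i < s) : bJ s k i = bI s k i := by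
  unfold bJ; rw [if_pos hi]

lemma join_params {n s : ℕ} {e : Fin n ≃ Fin n} {G : SimpleGraph (Fin n)} (hG : JoinG s e G) :
    muParam n G = n - s + 1 ∧ nuParam n G = n - s + 1 ∧ xiParam n G = n - s + 1 := by
  have hn := hG.core.hn
  have hs := hG.core.hs
  have hadj := hG.core.adj
  have hout : ∀ u v, u ≠ v → s ≤ (e v : ℕ) → G.Adj u v :=
    fun u v h1 h2 => (hG.out v u h1.symm h2).symm
  have hA := gram_desc (N := s - 1) (G := G)
    (fun k u => s ≤ (e u : ℕ) ∨ (e u : ℕ) = k ∨ (e u : ℕ) = k + 1) (by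
      intro u v huv
      have hne : (e u : ℕ) ≠ e v := fun h => huv (e.injective (Fin.ext h))
      by_cases hu : s ≤ (e u : ℕ)
      · refine iff_of_true ⟨if s ≤ (e v : ℕ) then 0 else (e v : ℕ) - 1, ?_, Or.inl hu, ?_⟩
          (hG.out u v huv hu) <;> split_ifs <;> omega
      by_cases hv : s ≤ (e v : ℕ)
      · exact iff_of_true ⟨(e u : ℕ) - 1, by omega, by omega, Or.inl hv⟩ (hout u v huv hv)
      rw [hadj u v (by omega) (by omega)]
      constructor
      · rintro ⟨k, hk, h1, h2⟩; omega
      · intro h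
        exact ⟨min (e u : ℕ) (e v), by omega, by omega, by omega⟩)
  have hC := lor_desc (N := s - 1) (G := G) (fun k u => bJ s k (e u)) (by
      intro u v huv
      show -(bJ s 0 (e u) * bJ s 1 (e v) + bJ s 1 (e u) * bJ s 0 (e v)) +
        ∑ k ∈ Finset.Ico 2 (s - 1), bJ s k (e u) * bJ s k (e v) < 0
      by_cases hu : s ≤ (e u : ℕ)
      · by_cases hv : s ≤ (e v : ℕ)
        · exact bJ_out hs hu hv
        · have := bJ_mixed (j := e u) hs (show (e v : ℕ) < s by omega) hu
          refine lt_of_eq_of_lt ?_ this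
          congr 1
          · ring
          · exact Finset.sum_congr rfl fun k _ => mul_comm _ _
      by_cases hv : s ≤ (e v : ℕ)
      · exact bJ_mixed hs (by omega) hv
      simp only [bJ_lt (show (e u : ℕ) < s by omega), bJ_lt (show (e v : ℕ) < s by omega)]
      exact bI_path hs le_rfl (by omega) (by omega) ((hadj u v (by omega) (by omega)).1 huv)) (by
      intro u v huv hna
      have hne : (e u : ℕ) ≠ e v := fun h => huv (e.injective (Fin.ext h))
      have hu : (e u : ℕ) < s := by
        by_contra hc; exact hna (hG.out u v huv (by omega))
      have hv : (e v : ℕ) < s := by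
        by_contra hc; exact hna (hout u v huv (by omega))
      show -(bJ s 0 (e u) * bJ s 1 (e v) + bJ s 1 (e u) * bJ s 0 (e v)) +
        ∑ k ∈ Finset.Ico 2 (s - 1), bJ s k (e u) * bJ s k (e v) = 0
      simp only [bJ_lt hu, bJ_lt hv]
      refine bI_zero hs hne (fun h => hna ((hadj u v hu hv).2 h.2.2)))
  have hN : n - s + 1 = n - (s - 1) := by omega
  have hdiag : ∀ p : Fin n, (e p : ℕ) < 2 → lor (s - 1) (fun k u => bJ s k (e u)) p p = 0 := by
    intro p hp
    show -(bJ s 0 (e p) * bJ s 1 (e p) + bJ s 1 (e p) * bJ s 0 (e p)) +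
        ∑ k ∈ Finset.Ico 2 (s - 1), bJ s k (e p) * bJ s k (e p) = 0
    simp only [bJ_lt (show (e p : ℕ) < s by omega)]
    exact bI_diag hp
  obtain ⟨p, hp⟩ : ∃ p, e p = ⟨0, by omega⟩ := ⟨_, e.apply_symm_apply _⟩
  obtain ⟨q, hq⟩ : ∃ q, e q = ⟨1, by omega⟩ := ⟨_, e.apply_symm_apply _⟩
  have hpq : G.Adj p q := (hadj p q (by simp [hp]; omega) (by simp [hq]; omega)).2 (by simp [hp, hq])
  refine params_eq (fun A h _ => join_nullity hG h) _ hA (join_sap hG hA) (gram_psd _)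
    (hN ▸ gram_nullity _) _ hC.1 (join_sap hG hC.1) (lor_herm _)
    (lor_count _ p q (hdiag p (by simp [hp])) (hdiag q (by simp [hq])) ?_) hC.2
    (hN ▸ lor_nullity (by omega) _)
  exact lt_of_le_of_ne (hC.2 p q hpq.ne) ((hC.1.2 p q hpq.ne).2 hpq)

lemma iso_params {n s : ℕ} {e : Fin n ≃ Fin n} {G : SimpleGraph (Fin n)} (hG : IsoG s e G) :
    muParam n G = 1 ∧ nuParam n G = 1 ∧ xiParam n G = 1 := by
  have hn := hG.core.hn
  have hs := hG.core.hs
  have hadj := hG.core.adj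
  have hout : ∀ u v, s ≤ (e v : ℕ) → ¬ G.Adj u v :=
    fun u v h2 h => (hG.out v u h2) h.symm
  obtain ⟨R, hR⟩ : ∃ R : ℕ → Fin n → Prop, ∀ k u, R k u ↔
      ((k + 1 < s ∧ (e u : ℕ) = k) ∨ (e u : ℕ) = k + 1) := ⟨_, fun _ _ => Iff.rfl⟩
  have hA := gram_desc (N := n - 1) (G := G)
    R (by
      simp only [hR]
      intro u v huv
      have hne : (e u : ℕ) ≠ e v := fun h => huv (e.injective (Fin.ext h))
      by_cases hu : s ≤ (e u : ℕ)
      · refine iff_of_false ?_ (hG.out u v hu)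
        rintro ⟨k, hk, h1, h2⟩; omega
      by_cases hv : s ≤ (e v : ℕ)
      · refine iff_of_false ?_ (hout u v hv)
        rintro ⟨k, hk, h1, h2⟩; omega
      rw [hadj u v (by omega) (by omega)]
      constructor
      · rintro ⟨k, hk, h1, h2⟩; omega
      · intro h
        exact ⟨min (e u : ℕ) (e v), by omega, by omega, by omega⟩)
  have hAd : ∀ i, s ≤ (e i : ℕ) → gram (n - 1) (fun k u => if R k u then 1 else 0) i i ≠ 0 := by
    intro i hi
    have h : R ((e i : ℕ) - 1) i := by rw [hR]; omega
    exact (gram_ind R i i).2 ⟨(e i : ℕ) - 1, by omega, h, h⟩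
  have hC := lor_desc (N := n - 1) (G := G) (fun k u => bI s k (e u)) (by
      intro u v huv
      have hu : (e u : ℕ) < s := by
        by_contra hc; exact (hG.out u v (by omega)) huv
      have hv : (e v : ℕ) < s := by
        by_contra hc; exact (hout u v (by omega)) huv
      exact bI_path hs (by omega) hu hv ((hadj u v hu hv).1 huv)) (by
      intro u v huv hna
      have hne : (e u : ℕ) ≠ e v := fun h => huv (e.injective (Fin.ext h))
      exact bI_zero hs hne (fun h => hna ((hadj u v h.1 h.2.1).2 h.2.2)))
  have hCd : ∀ i, s ≤ (e i : ℕ) → lor (n - 1) (fun k u => bI s k (e u)) i i ≠ 0 := by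
    intro i hi
    show -(bI s 0 (e i) * bI s 1 (e i) + bI s 1 (e i) * bI s 0 (e i)) +
        ∑ k ∈ Finset.Ico 2 (n - 1), bI s k (e i) * bI s k (e i) ≠ 0
    have h0 : bI s 0 (e i) = 0 := by
      unfold bI; rw [if_pos rfl, if_neg (by omega)]
    rw [h0]
    simp only [zero_mul, mul_zero, add_zero, neg_zero, zero_add]
    refine (Finset.sum_pos' (fun k _ => mul_self_nonneg _) ⟨(e i : ℕ) - 1, ?_, ?_⟩).ne'
    · rw [Finset.mem_Ico]; omega
    · unfold bI
      rw [if_neg (by omega), if_neg (by omega), if_neg (by omega), if_pos (by omega)]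
      norm_num
  have hN : 1 = n - (n - 1) := by omega
  have hdiag : ∀ p : Fin n, (e p : ℕ) < 2 → lor (n - 1) (fun k u => bI s k (e u)) p p = 0 :=
    fun p hp => bI_diag hp
  obtain ⟨p, hp⟩ : ∃ p, e p = ⟨0, by omega⟩ := ⟨_, e.apply_symm_apply _⟩
  obtain ⟨q, hq⟩ : ∃ q, e q = ⟨1, by omega⟩ := ⟨_, e.apply_symm_apply _⟩
  have hpq : G.Adj p q := (hadj p q (by simp [hp]; omega) (by simp [hq]; omega)).2 (by simp [hp, hq])
  refine params_eq (fun A h h' => iso_nullity hG h h') _ hA (iso_sap hG hA hAd) (gram_psd _)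
    (hN.le.trans (gram_nullity _)) _ hC.1 (iso_sap hG hC.1 hCd) (lor_herm _)
    (lor_count _ p q (hdiag p (by simp [hp])) (hdiag q (by simp [hq])) ?_) hC.2
    (hN.le.trans (lor_nullity (by omega) _))
  exact lt_of_le_of_ne (hC.2 p q hpq.ne) ((hC.1.2 p q hpq.ne).2 hpq)

end NG

namespace NG

lemma join_width {n s : ℕ} {e : Fin n ≃ Fin n} {G : SimpleGraph (Fin n)} (hG : JoinG s e G) :
    treewidth n G = n - s + 1 ∧ la n G = n - s + 1 ∧ pw n G = n - s + 1 ∧ ppw n G = n - s + 1 := by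
  have hn := hG.core.hn
  have hs := hG.core.hs
  have hadj := hG.core.adj
  let f : Fin n ↪ Fin n := ⟨fun u => ⟨if s ≤ (e u : ℕ) then (e u : ℕ) - s else (e u : ℕ) + (n - s),
    by split_ifs <;> omega⟩, by
      intro u v h
      simp only [Fin.ext_iff] at h
      apply e.injective
      apply Fin.ext
      split_ifs at h <;> omega⟩
  have hfv : ∀ u, (f u : ℕ) = if s ≤ (e u : ℕ) then (e u : ℕ) - s else (e u : ℕ) + (n - s) :=
    fun u => rfl
  let g : Fin (n - s + 2) → Fin n := fun a =>
    e.symm ⟨if (a : ℕ) < 2 then a else (a : ℕ) - 2 + s, by split_ifs <;> omega⟩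
  have hgv : ∀ a, (e (g a) : ℕ) = if (a : ℕ) < 2 then (a : ℕ) else (a : ℕ) - 2 + s := by
    intro a; simp [g]
  refine width_all (by omega) G f ?_ g ?_
  · intro u v huv
    have hne : (f u : ℕ) ≠ f v := fun h => huv.ne (f.injective (Fin.ext h))
    rw [LK_adj]
    refine ⟨hne, ?_⟩
    rw [hfv, hfv]
    by_cases hu : s ≤ (e u : ℕ)
    · left; rw [if_pos hu]; omega
    by_cases hv : s ≤ (e v : ℕ)
    · right; left; rw [if_pos hv]; omega
    have := (hadj u v (by omega) (by omega)).1 huv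
    rw [if_neg hu, if_neg hv]; omega
  · intro a b hab
    have hab' : (a : ℕ) ≠ b := fun h => hab (Fin.ext h)
    have ha := hgv a
    have hb := hgv b
    have hne : g a ≠ g b := by
      intro h
      rw [h, hb] at ha
      split_ifs at ha <;> omega
    by_cases h1 : (a : ℕ) < 2
    · by_cases h2 : (b : ℕ) < 2
      · rw [if_pos h1] at ha
        rw [if_pos h2] at hb
        exact (hadj _ _ (by omega) (by omega)).2 (by omega)
      · rw [if_neg h2] at hb
        exact (hG.out _ _ hne.symm (by omega)).symm
    · rw [if_neg h1] at ha
      exact hG.out _ _ hne (by omega)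

lemma iso_width {n s : ℕ} {e : Fin n ≃ Fin n} {G : SimpleGraph (Fin n)} (hG : IsoG s e G) :
    treewidth n G = 1 ∧ la n G = 1 ∧ pw n G = 1 ∧ ppw n G = 1 := by
  have hn := hG.core.hn
  have hs := hG.core.hs
  have hadj := hG.core.adj
  let g : Fin (0 + 2) → Fin n := fun a => e.symm ⟨a, by omega⟩
  have hgv : ∀ a, (e (g a) : ℕ) = a := by
    intro a; simp [g]
  refine width_all (m := 0) (by omega) G e.toEmbedding ?_ g ?_
  · intro u v huv
    have hne : (e u : ℕ) ≠ e v := fun h => huv.ne (e.injective (Fin.ext h))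
    rw [LK_adj]
    have hu : (e u : ℕ) < s := by
      by_contra hc; exact (hG.out u v (by omega)) huv
    have hv : (e v : ℕ) < s := by
      by_contra hc; exact (hG.out v u (by omega)) huv.symm
    have := (hadj u v (by omega) (by omega)).1 huv
    simp only [Equiv.coe_toEmbedding]
    omega
  · intro a b hab
    have hab' : (a : ℕ) ≠ b := fun h => hab (Fin.ext h)
    have ha := hgv a
    have hb := hgv b
    exact (hadj _ _ (by omega) (by omega)).2 (by omega)

/-- index of the part containing the edge -/
def idx (r u v : ℕ) : ℕ :=
  if u < 2 * r ∧ v < 2 * r then (if u + v < 2 * r then (u + v) / 2 else (u + v - 2 * r) / 2)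
  else r - 1

lemma idx_comm (r u v : ℕ) : idx r u v = idx r v u := by
  unfold idx
  simp only [add_comm u v, and_comm]

lemma idx_lt {r : ℕ} (hr : 2 ≤ r) (u v : ℕ) : idx r u v < r := by
  unfold idx
  split_ifs <;> omega

/-- the parts -/
def part (r n : ℕ) (i : ℕ) : SimpleGraph (Fin n) where
  Adj u v := u ≠ v ∧ idx r u v = i
  symm := ⟨by
    intro u v h
    exact ⟨h.1.symm, by rw [idx_comm]; exact h.2⟩⟩
  loopless := ⟨by intro u h; exact h.1 rfl⟩

/-- position along the zigzag -/
def zd (r i v : ℕ) : ℕ := if v ≤ i then i - v else i + 2 * r - v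

/-- position along the zigzag -/
def zpos (r i v : ℕ) : ℕ :=
  if v < 2 * r then (if zd r i v < r then 2 * zd r i v else 4 * r - 1 - 2 * zd r i v) else v

lemma zd_lt {r i v : ℕ} (hi : i < r) (hv : v < 2 * r) : zd r i v < 2 * r := by
  unfold zd; split_ifs <;> omega

lemma zpos_lt {r i v : ℕ} (hi : i < r) (hv : v < 2 * r) : zpos r i v < 2 * r := by
  have := zd_lt hi hv
  unfold zpos; split_ifs <;> omega

lemma zpos_ge {r i v : ℕ} (hv : 2 * r ≤ v) : zpos r i v = v := by
  unfold zpos; rw [if_neg (by omega)]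

lemma zpos_inj {r i u v : ℕ} (hi : i < r) (h : zpos r i u = zpos r i v) : u = v := by
  by_cases hu : u < 2 * r
  · by_cases hv : v < 2 * r
    · have h1 := zd_lt hi hu
      have h2 := zd_lt hi hv
      have h3 : zd r i u = zd r i v := by
        unfold zpos at h
        rw [if_pos hu, if_pos hv] at h
        split_ifs at h <;> omega
      unfold zd at h3
      split_ifs at h3 <;> omega
    · have := zpos_lt hi hu
      rw [zpos_ge (v := v) (by omega)] at h; omega
  · by_cases hv : v < 2 * r
    · have := zpos_lt hi hv
      rw [zpos_ge (v := u) (by omega)] at h; omega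
    · rwa [zpos_ge (by omega), zpos_ge (by omega)] at h

lemma zpos_adj {r i u v : ℕ} (hi : i < r) (hu : u < 2 * r) (hv : v < 2 * r) :
    (u ≠ v ∧ idx r u v = i) ↔ (zpos r i u + 1 = zpos r i v ∨ zpos r i v + 1 = zpos r i u) := by
  unfold idx zpos
  rw [if_pos ⟨hu, hv⟩, if_pos hu, if_pos hv]
  unfold zd
  by_cases h1 : u ≤ i <;> by_cases h2 : v ≤ i <;> simp only [h1, h2, if_true, if_false] <;>
    split_ifs <;> omega

/-- the relabelling -/
noncomputable def zeq (r n i : ℕ) (hi : i < r) (hn : 2 * r ≤ n) : Fin n ≃ Fin n :=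
  Equiv.ofBijective (fun v => (⟨zpos r i v, by
    by_cases hv : (v : ℕ) < 2 * r
    · have := zpos_lt hi hv; omega
    · rw [zpos_ge (by omega)]; exact v.2⟩ : Fin n)) (by
    rw [← Finite.injective_iff_bijective]
    intro u v h
    simp only [Fin.ext_iff] at h
    exact Fin.ext (zpos_inj hi h))

lemma zeq_val {r n i : ℕ} (hi : i < r) (hn : 2 * r ≤ n) (v : Fin n) :
    (zeq r n i hi hn v : ℕ) = zpos r i v := rfl

lemma zeq_lt {r n i : ℕ} (hi : i < r) (hn : 2 * r ≤ n) (v : Fin n) :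
    (zeq r n i hi hn v : ℕ) < 2 * r ↔ (v : ℕ) < 2 * r := by
  rw [zeq_val]
  constructor
  · intro h
    by_contra hc
    rw [zpos_ge (by omega)] at h; omega
  · exact zpos_lt hi

lemma part_core {r n i : ℕ} (hr : 2 ≤ r) (hi : i < r) (hn : 2 * r ≤ n) :
    PathCore (2 * r) (zeq r n i hi hn) (part r n i) := by
  refine ⟨by omega, hn, fun u v hu hv => ?_⟩
  rw [zeq_lt] at hu hv
  rw [zeq_val, zeq_val, ← zpos_adj hi hu hv]
  simp [part, Fin.ext_iff]

lemma part_join {r n : ℕ} (hr : 2 ≤ r) (hn : 2 * r ≤ n) :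
    JoinG (2 * r) (zeq r n (r - 1) (by omega) hn) (part r n (r - 1)) := by
  refine ⟨part_core hr _ hn, fun u v huv hu => ⟨huv, ?_⟩⟩
  have := zeq_lt (show r - 1 < r by omega) hn u
  unfold idx
  rw [if_neg (by omega)]

lemma part_iso {r n i : ℕ} (hr : 2 ≤ r) (hi : i < r) (hi' : i ≠ r - 1) (hn : 2 * r ≤ n) :
    IsoG (2 * r) (zeq r n i hi hn) (part r n i) := by
  refine ⟨part_core hr _ hn, fun u v hu h => ?_⟩
  have h1 := zeq_lt hi hn u
  have h2 := h.2
  unfold idx at h2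
  rw [if_neg (by omega)] at h2
  omega

lemma iso_path {n s : ℕ} {e : Fin n ≃ Fin n} {G : SimpleGraph (Fin n)} (hG : IsoG s e G) :
    IsPathGraph G := by
  have hn := hG.core.hn
  have hs := hG.core.hs
  have hadj := hG.core.adj
  refine ⟨s - 1, ⟨fun a => e.symm ⟨a, by omega⟩, ?_⟩, fun u v => ?_⟩
  · intro a b h
    have := e.symm.injective h
    simp only [Fin.mk.injEq] at this
    exact Fin.ext this
  · have hk : ∀ (w : Fin n) (a : Fin (s - 1 + 1)),
        w = e.symm ⟨a, by omega⟩ ↔ (e w : ℕ) = a := by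
      intro w a
      rw [Equiv.eq_symm_apply, Fin.ext_iff]
    show _ ↔ ∃ a b : Fin (s - 1 + 1), (a : ℕ) + 1 = (b : ℕ) ∧
      ((u = e.symm ⟨a, by omega⟩ ∧ v = e.symm ⟨b, by omega⟩) ∨
        (u = e.symm ⟨b, by omega⟩ ∧ v = e.symm ⟨a, by omega⟩))
    simp only [hk]
    constructor
    · intro huv
      have hu : (e u : ℕ) < s := by
        by_contra hc; exact (hG.out u v (by omega)) huv
      have hv : (e v : ℕ) < s := by
        by_contra hc; exact (hG.out v u (by omega)) huv.symm
      rcases (hadj u v hu hv).1 huv with h | h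
      · exact ⟨⟨e u, by omega⟩, ⟨e v, by omega⟩, h, Or.inl ⟨rfl, rfl⟩⟩
      · exact ⟨⟨e v, by omega⟩, ⟨e u, by omega⟩, h, Or.inr ⟨rfl, rfl⟩⟩
    · rintro ⟨a, b, hab, h⟩
      exact (hadj u v (by omega) (by omega)).2 (by omega)

lemma core_ne_bot {n s : ℕ} {e : Fin n ≃ Fin n} {G : SimpleGraph (Fin n)} (hG : PathCore s e G) :
    G ≠ ⊥ := by
  have hn := hG.hn
  have hs := hG.hs
  rintro rfl
  have := (hG.adj (e.symm ⟨0, by omega⟩) (e.symm ⟨1, by omega⟩) (by simp; omega)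
    (by simp; omega)).2 (by simp)
  simp at this

lemma part_decomp {r n : ℕ} (hr : 2 ≤ r) (hn : 2 * r ≤ n) :
    IsNDDecomp (fun i : Fin r => part r n i) := by
  refine ⟨⟨fun i j hij => ?_, ?_⟩, fun i => core_ne_bot (part_core hr i.2 hn)⟩
  · rw [SimpleGraph.disjoint_left]
    intro u v h1 h2
    exact hij (Fin.ext (h1.2.symm.trans h2.2))
  · ext u v
    rw [SimpleGraph.iSup_adj, SimpleGraph.top_adj]
    constructor
    · rintro ⟨i, h⟩; exact h.1
    · intro h
      exact ⟨⟨idx r u v, idx_lt hr _ _⟩, h, rfl⟩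

end NG

/-- For `β ∈ {μ, ν, ξ, tw, la, pw, ppw}`, `r ≥ 2` and `n ≥ 2r`:
`NGΣ↓_β(r;n) ≤ NGΣ↓ⁿ_β(r;n) ≤ n − r`, and `n − r` is realized by a
non-degenerate decomposition in which all but at most one of the graphs are
paths (with isolated vertices). -/
theorem statement11 (r n : ℕ) (hr : 2 ≤ r) (hn : 2 * r ≤ n)
    (β : (m : ℕ) → SimpleGraph (Fin m) → ℕ)
    (hβ : β = NG.muParam ∨ β = NG.nuParam ∨ β = NG.xiParam ∨
      β = NG.treewidth ∨ β = NG.la ∨ β = NG.pw ∨ β = NG.ppw) :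
    NG.NGsumLow (β n) r ≤ NG.NGsumLowND (β n) r ∧
    NG.NGsumLowND (β n) r ≤ n - r ∧
    ∃ G : Fin r → SimpleGraph (Fin n), NG.IsNDDecomp G ∧
      (∑ i, β n (G i)) = n - r ∧
      ∃ i₀ : Fin r, ∀ i, i ≠ i₀ → NG.IsPathGraph (G i) := by
  have hdec := NG.part_decomp hr hn
  have hJ : β n (NG.part r n (r - 1)) = n - 2 * r + 1 := by
    have h1 := NG.join_params (NG.part_join hr hn)
    have h2 := NG.join_width (NG.part_join hr hn)
    rcases hβ with rfl | rfl | rfl | rfl | rfl | rfl | rfl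
    · exact h1.1
    · exact h1.2.1
    · exact h1.2.2
    · exact h2.1
    · exact h2.2.1
    · exact h2.2.2.1
    · exact h2.2.2.2
  have hI : ∀ i, i < r → i ≠ r - 1 → β n (NG.part r n i) = 1 := by
    intro i hi hi'
    have h1 := NG.iso_params (NG.part_iso hr hi hi' hn)
    have h2 := NG.iso_width (NG.part_iso hr hi hi' hn)
    rcases hβ with rfl | rfl | rfl | rfl | rfl | rfl | rfl
    · exact h1.1
    · exact h1.2.1
    · exact h1.2.2
    · exact h2.1
    · exact h2.2.1
    · exact h2.2.2.1
    · exact h2.2.2.2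
  have hsum : ∑ i : Fin r, β n (NG.part r n i) = n - r := by
    rw [Fin.sum_univ_eq_sum_range (fun i => β n (NG.part r n i)) r]
    obtain ⟨q, rfl⟩ : ∃ q, r = q + 1 := ⟨r - 1, by omega⟩
    rw [Finset.sum_range_succ, Finset.sum_congr rfl (g := fun _ => 1)]
    · have : q + 1 - 1 = q := by omega
      rw [this] at hJ
      rw [hJ]
      simp
      omega
    · intro i hi
      rw [Finset.mem_range] at hi
      exact hI i (by omega) (by omega)
  refine ⟨?_, Nat.sInf_le ⟨_, hdec, hsum⟩, _, hdec, hsum, ⟨r - 1, by omega⟩, fun i hi => ?_⟩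
  · have hne : {s | ∃ G : Fin r → SimpleGraph (Fin n), NG.IsNDDecomp G ∧
        ∑ i, β n (G i) = s}.Nonempty := ⟨_, _, hdec, hsum⟩
    obtain ⟨G, hG, hs⟩ := Nat.sInf_mem hne
    exact Nat.sInf_le ⟨G, hG.1, hs⟩
  · exact NG.iso_path (NG.part_iso hr i.2 (fun h => hi (Fin.ext h)) hn)
end

section
/- Let β ∈ {tw, la, pw, ppw} and fix an integer r ≥ 2. Then NGΠ↑_β(r;n) = NGΠ↑ⁿ_β(r;n) for all n admitting a non-degenerate r-decomposition, and NGΠ↑_β(r;n) = n^r − o(n^r); that is, lim_{n→∞} NGΠ↑_β(r;n)/n^r = 1. -/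
open scoped Classical

namespace NGaux
open NG Finset

def IsPar {N : ℕ} (H : SimpleGraph (Fin N)) (v p : Fin N) : Prop :=
  p ∈ backNbhd H v ∧ ∀ u ∈ backNbhd H v, u ≤ p

inductive Desc {N : ℕ} (H : SimpleGraph (Fin N)) (j : Fin N) : Fin N → Prop
  | refl : Desc H j j
  | step (v p : Fin N) : IsPar H v p → Desc H j p → Desc H j v

theorem mem_back {N : ℕ} {H : SimpleGraph (Fin N)} {i j : Fin N} :
    i ∈ backNbhd H j ↔ i < j ∧ H.Adj i j := by
  simp [backNbhd]

theorem exists_par {N : ℕ} {H : SimpleGraph (Fin N)} {u v : Fin N}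
    (hu : u ∈ backNbhd H v) : ∃ p, IsPar H v p :=
  ⟨(backNbhd H v).max' ⟨u, hu⟩, Finset.max'_mem _ _, fun w hw => Finset.le_max' _ w hw⟩

theorem par_back {N : ℕ} {H : SimpleGraph (Fin N)}
    (hc : ∀ v, H.IsClique (backNbhd H v : Set (Fin N))) {u v p : Fin N}
    (hp : IsPar H v p) (hu : u ∈ backNbhd H v) (hne : u ≠ p) : u ∈ backNbhd H p := by
  rw [mem_back]
  exact ⟨lt_of_le_of_ne (hp.2 u hu) hne, hc v (by exact_mod_cast hu) (by exact_mod_cast hp.1) hne⟩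

theorem desc_of_back {N : ℕ} {H : SimpleGraph (Fin N)}
    (hc : ∀ v, H.IsClique (backNbhd H v : Set (Fin N))) {u : Fin N} :
    ∀ v, u ∈ backNbhd H v → Desc H u v := by
  intro v
  induction v using WellFoundedLT.induction with
  | _ v ih =>
    intro hu
    obtain ⟨p, hp⟩ := exists_par hu
    by_cases hne : u = p
    · subst hne; exact Desc.step v u hp Desc.refl
    · exact Desc.step v p hp (ih p (mem_back.1 hp.1).1 (par_back hc hp hu hne))

theorem desc_boundary {N : ℕ} {H : SimpleGraph (Fin N)}
    (hc : ∀ v, H.IsClique (backNbhd H v : Set (Fin N))) {j u v : Fin N}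
    (hv : Desc H j v) (hu : ¬ Desc H j u) (ha : H.Adj u v) : u ∈ backNbhd H j := by
  have trans' : ∀ {a b c : Fin N}, Desc H a b → Desc H b c → Desc H a c := by
    intro a b c h1 h2
    induction h2 with
    | refl => exact h1
    | step v p hp _ ih => exact Desc.step v p hp ih
  have hback : u ∈ backNbhd H v := by
    rw [mem_back]
    refine ⟨?_, ha⟩
    rcases lt_trichotomy u v with h | h | h
    · exact h
    · exact absurd (h ▸ ha) (H.loopless.irrefl _)
    · exact absurd (trans' hv (desc_of_back hc u (mem_back.2 ⟨h, ha.symm⟩))) hu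
  clear ha
  induction hv with
  | refl => exact hback
  | step v p hp hd ih =>
    apply ih
    refine par_back hc hp hback ?_
    rintro rfl
    exact hu hd

theorem desc_child {N : ℕ} {H : SimpleGraph (Fin N)} {j v : Fin N}
    (hv : Desc H j v) : v = j ∨ ∃ c, IsPar H c j ∧ Desc H c v := by
  induction hv with
  | refl => exact Or.inl rfl
  | step v p hp _ ih =>
    right
    rcases ih with rfl | ⟨c, h1, h2⟩
    · exact ⟨v, hp, Desc.refl⟩
    · exact ⟨c, h1, Desc.step v p hp h2⟩

theorem desc_all {N : ℕ} {H : SimpleGraph (Fin N)} {z : Fin N}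
    (hne : ∀ v, v ≠ z → ∃ u, u ∈ backNbhd H v) : ∀ v, Desc H z v := by
  intro v
  induction v using WellFoundedLT.induction with
  | _ v ih =>
    by_cases h : v = z
    · subst h; exact Desc.refl
    · obtain ⟨u, hu⟩ := hne v h
      obtain ⟨p, hp⟩ := exists_par hu
      exact Desc.step v p hp (ih p (mem_back.1 hp.1).1)

theorem ktree_facts {k N : ℕ} {H : SimpleGraph (Fin N)} (h : IsKTreeOrd k N H) :
    (∀ v, H.IsClique (backNbhd H v : Set (Fin N))) ∧ (∀ v, (backNbhd H v).card ≤ k) ∧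
    ∃ z : Fin N, ∀ v, v ≠ z → ∃ u, u ∈ backNbhd H v := by
  obtain ⟨hk, hN, h1, h2⟩ := h
  refine ⟨?_, ?_, ⟨0, by omega⟩, ?_⟩
  · intro v
    by_cases hv : k < (v : ℕ)
    · exact (h2 v hv).2
    · intro a ha b hb hab
      have ha' := (mem_back.1 (by exact_mod_cast ha : a ∈ backNbhd H v)).1
      have hb' := (mem_back.1 (by exact_mod_cast hb : b ∈ backNbhd H v)).1
      rcases lt_or_gt_of_ne hab with h | h
      · exact h1 a b h (by have : (b : ℕ) < v := hb'; omega)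
      · exact (h1 b a h (by have : (a : ℕ) < v := ha'; omega)).symm
  · intro v
    by_cases hv : k < (v : ℕ)
    · exact (h2 v hv).1.le
    · have : backNbhd H v ⊆ Finset.Iio v := fun a ha => Finset.mem_Iio.2 (mem_back.1 ha).1
      have := Finset.card_le_card this
      rw [Fin.card_Iio] at this
      omega
  · intro v hv
    by_cases hv' : k < (v : ℕ)
    · have := (h2 v hv').1
      have : 0 < (backNbhd H v).card := by omega
      exact Finset.card_pos.1 this
    · have h0 : 0 < (v : ℕ) := by
        rcases Nat.eq_zero_or_pos (v : ℕ) with h | h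
        · exact absurd (Fin.ext h) hv
        · exact h
      exact ⟨⟨0, by omega⟩, mem_back.2 ⟨h0, h1 _ _ h0 (by omega)⟩⟩

theorem ktree_bound {n k N m : ℕ} (hm : 1 ≤ m) (G : SimpleGraph (Fin n))
    (hG : ∀ A B : Finset (Fin n), A.card = m → B.card = m → Disjoint A B →
      ∃ a ∈ A, ∃ b ∈ B, G.Adj a b)
    (H : SimpleGraph (Fin N)) (hH : IsKTreeOrd k N H) (f : Fin n ↪ Fin N)
    (hf : ∀ u v, G.Adj u v → H.Adj (f u) (f v)) : n ≤ k + 3 * m := by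
  obtain ⟨hc, hcard, z, hz⟩ := ktree_facts hH
  by_contra hlt
  push Not at hlt
  have hall := desc_all hz
  let W : Fin N → Finset (Fin n) := fun j => univ.filter (fun x => Desc H j (f x))
  have hJ : (univ.filter (fun j => m + 1 ≤ (W j).card)).Nonempty := by
    refine ⟨z, ?_⟩
    have : W z = univ := by ext x; simp [W, hall]
    simp [this]; omega
  let j := Finset.max' _ hJ
  have hj : m + 1 ≤ (W j).card := (Finset.mem_filter.1 (Finset.max'_mem _ hJ)).2
  have hjmax : ∀ c, j < c → (W c).card ≤ m := by
    intro c hc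
    by_contra hcon
    push Not at hcon
    exact absurd (Finset.le_max' _ c (by simp; omega)) (not_le.2 hc)
  let U : Finset (Fin N) → Finset (Fin n) := fun S => S.biUnion W
  let Ch : Finset (Fin N) := univ.filter (fun c => IsPar H c j)
  have hCh : m ≤ (U Ch).card := by
    have hsub : (W j) ⊆ U Ch ∪ univ.filter (fun x => f x = j) := by
      intro x hx
      simp only [W, mem_filter, mem_univ, true_and] at hx
      rcases desc_child hx with h | ⟨c, h1, h2⟩
      · simp [h]
      · apply mem_union_left
        simp only [U, mem_biUnion]
        exact ⟨c, by simp [Ch, h1], by simp [W, h2]⟩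
    have h1 := (card_le_card hsub).trans (card_union_le _ _)
    have h2 : (univ.filter (fun x => f x = j)).card ≤ 1 := by
      rw [card_le_one]
      intro a ha b hb
      simp at ha hb
      exact f.injective (ha.trans hb.symm)
    omega
  have hex : (Ch.powerset.filter (fun S => m ≤ (U S).card)).Nonempty :=
    ⟨Ch, by simp [hCh]⟩
  obtain ⟨S, hS, hmin⟩ := Finset.exists_min_image _ Finset.card hex
  simp only [mem_filter, mem_powerset] at hS hmin
  obtain ⟨hSC, hSm⟩ := hS
  have hSne : S.Nonempty := by
    rw [nonempty_iff_ne_empty]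
    rintro rfl
    simp [U] at hSm
    omega
  obtain ⟨c, hcS⟩ := hSne
  have hSc : (U (S.erase c)).card < m := by
    by_contra hcon
    push Not at hcon
    have := hmin (S.erase c) ⟨(erase_subset _ _).trans hSC, hcon⟩
    have := card_erase_lt_of_mem hcS
    omega
  have hcm : (W c).card ≤ m := by
    apply hjmax
    have := hSC hcS
    simp only [Ch, mem_filter, mem_univ, true_and] at this
    exact (mem_back.1 this.1).1
  have hUS : (U S).card < 2 * m := by
    have : U S = W c ∪ U (S.erase c) := by
      simp only [U]
      rw [← biUnion_insert, insert_erase hcS]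
    have h2 := card_union_le (W c) (U (S.erase c))
    rw [← this] at h2
    omega
  let K : Finset (Fin n) := univ.filter (fun x => f x ∈ insert j (backNbhd H j))
  have hK : K.card ≤ k + 1 := by
    have h1 : K.card ≤ (insert j (backNbhd H j)).card := by
      apply card_le_card_of_injOn f
      · intro x hx
        simpa [K] using hx
      · exact f.injective.injOn
    have h2 := card_insert_le j (backNbhd H j)
    have := hcard j
    omega
  let R : Finset (Fin n) := univ \ (U S ∪ K)
  have hR : m ≤ R.card := by
    have h1 := le_card_sdiff (U S ∪ K) (univ : Finset (Fin n))
    have h2 := card_union_le (U S) K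
    simp only [card_univ, Fintype.card_fin] at h1
    change m ≤ (univ \ (U S ∪ K)).card
    omega
  obtain ⟨A, hA, hAm⟩ := exists_subset_card_eq hSm
  obtain ⟨B, hB, hBm⟩ := exists_subset_card_eq hR
  have hd : Disjoint A B := by
    rw [disjoint_left]
    intro x hx hx'
    have := hB hx'
    simp only [R, mem_sdiff, mem_union] at this
    exact this.2 (Or.inl (hA hx))
  obtain ⟨a, ha, b, hb, hab⟩ := hG A B hAm hBm hd
  have hb' := hB hb
  simp only [R, mem_sdiff, mem_union, not_or] at hb'
  obtain ⟨c', hc', hac'⟩ := mem_biUnion.1 (hA ha)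
  have hdesc : Desc H c' (f a) := by simpa [W] using hac'
  have hnd : ¬ Desc H c' (f b) := by
    intro h
    exact hb'.2.1 (mem_biUnion.2 ⟨c', hc', by simp [W, h]⟩)
  have hbd := desc_boundary hc hdesc hnd (hf _ _ hab).symm
  have hpar : IsPar H c' j := by simpa [Ch] using hSC hc'
  apply hb'.2.2
  simp only [K, mem_filter, mem_univ, true_and, mem_insert]
  by_cases h : f b = j
  · exact Or.inl h
  · exact Or.inr (par_back hc hpar hbd h)

theorem tw_lower {n m : ℕ} (hm : 1 ≤ m) (G : SimpleGraph (Fin n))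
    (hG : ∀ A B : Finset (Fin n), A.card = m → B.card = m → Disjoint A B →
      ∃ a ∈ A, ∃ b ∈ B, G.Adj a b)
    (P : ℕ → (N : ℕ) → SimpleGraph (Fin N) → Prop)
    (hP : ∀ k N H, P k N H → IsKTreeOrd k N H)
    (hP2 : ∀ n, 2 ≤ n → P (n - 1) n ⊤) : n - 3 * m ≤ widthParam P n G := by
  by_cases h3 : n ≤ 3 * m
  · omega
  push Not at h3
  have hne : G ≠ ⊥ := by
    rintro rfl
    obtain ⟨A, hA, hAm⟩ := exists_subset_card_eq (s := (univ : Finset (Fin n))) (n := m)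
      (by simp; omega)
    obtain ⟨B, hB, hBm⟩ := exists_subset_card_eq (s := (univ \ A : Finset (Fin n))) (n := m)
      (by
        have := le_card_sdiff A (univ : Finset (Fin n))
        simp only [card_univ, Fintype.card_fin] at this
        omega)
    obtain ⟨a, _, b, _, hab⟩ := hG A B hAm hBm (by
      rw [disjoint_left]
      intro x hx hx'
      have := hB hx'
      simp [hx] at this)
    exact hab
  unfold widthParam
  rw [if_neg hne]
  have hnon : {k | ∃ (N : ℕ) (H : SimpleGraph (Fin N)) (f : Fin n ↪ Fin N),
    P k N H ∧ ∀ u v : Fin n, G.Adj u v → H.Adj (f u) (f v)}.Nonempty :=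
    ⟨n - 1, n, ⊤, Function.Embedding.refl _, hP2 n (by omega), fun u v h => h.ne⟩
  obtain ⟨N, H, f, hPk, hf⟩ := Nat.sInf_mem hnon
  have := ktree_bound hm G hG H (hP _ _ _ hPk) f hf
  omega

theorem width_upper {n : ℕ} (G : SimpleGraph (Fin n))
    (P : ℕ → (N : ℕ) → SimpleGraph (Fin N) → Prop)
    (hP2 : ∀ n, 2 ≤ n → P (n - 1) n ⊤) : widthParam P n G ≤ n := by
  unfold widthParam
  split_ifs with h
  · omega
  · have hn : 2 ≤ n := by
      by_contra hn
      have : Subsingleton (Fin n) := Fin.subsingleton_iff_le_one.2 (by omega)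
      apply h
      ext u v
      simp [Subsingleton.elim u v]
    refine (Nat.sInf_le ?_).trans (Nat.sub_le n 1)
    exact ⟨n, ⊤, Function.Embedding.refl _, hP2 n hn, fun u v h => h.ne⟩

theorem ktree_top (n : ℕ) (hn : 2 ≤ n) : IsKTreeOrd (n - 1) n ⊤ := by
  refine ⟨by omega, by omega, ?_, ?_⟩
  · intro i j h _ 
    simp only [SimpleGraph.top_adj]
    rintro rfl
    omega
  · intro j hj
    omega

/-- colourings avoiding a colour on a set -/
theorem card_avoid {α : Type*} [Fintype α] [DecidableEq α] {r : ℕ} (E : Finset α) (i : Fin r) :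
    (univ.filter (fun c : α → Fin r => ∀ e ∈ E, c e ≠ i)).card
      = (r - 1) ^ E.card * r ^ (Fintype.card α - E.card) := by
  have : (univ.filter (fun c : α → Fin r => ∀ e ∈ E, c e ≠ i))
      = Fintype.piFinset (fun e => if e ∈ E then univ.erase i else univ) := by
    ext c
    simp only [mem_filter, mem_univ, true_and, Fintype.mem_piFinset]
    refine forall_congr' fun e => ?_
    by_cases h : e ∈ E <;> simp [h]
  rw [this, Fintype.card_piFinset]
  have h2 : ∀ e, (if e ∈ E then (univ : Finset (Fin r)).erase i else univ).card
      = if e ∈ E then r - 1 else r := by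
    intro e
    split_ifs <;> simp
  simp only [h2]
  rw [Finset.prod_ite]
  simp only [prod_const]
  congr 2
  · congr 1; ext; simp
  · rw [← card_compl]
    congr 1; ext; simp

theorem exists_coloring {n m r : ℕ} (hr : 2 ≤ r)
    (h : 4 ^ n * r * (r - 1) ^ (m * m) < r ^ (m * m)) :
    ∃ c : Sym2 (Fin n) → Fin r, ∀ A B : Finset (Fin n), A.card = m → B.card = m →
      Disjoint A B → ∀ i, ∃ a ∈ A, ∃ b ∈ B, c s(a, b) = i := by
  by_contra hcon
  push Not at hcon
  let α := Sym2 (Fin n)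
  let E : Finset (Fin n) × Finset (Fin n) → Finset α := fun p =>
    (p.1 ×ˢ p.2).image (fun q => s(q.1, q.2))
  let T : Finset ((Finset (Fin n) × Finset (Fin n)) × Fin r) :=
    univ.filter (fun t => t.1.1.card = m ∧ t.1.2.card = m ∧ Disjoint t.1.1 t.1.2)
  let F : ((Finset (Fin n) × Finset (Fin n)) × Fin r) → Finset (α → Fin r) := fun t =>
    univ.filter (fun c => ∀ e ∈ E t.1, c e ≠ t.2)
  have hE : ∀ t ∈ T, (E t.1).card = m * m := by
    rintro ⟨⟨A, B⟩, i⟩ ht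
    simp only [T, mem_filter, mem_univ, true_and] at ht
    obtain ⟨h1, h2, h3⟩ := ht
    simp only [E]
    rw [card_image_of_injOn, card_product, h1, h2]
    rintro ⟨a, b⟩ hab ⟨a', b'⟩ hab' heq
    simp only [coe_product, Set.mem_prod, mem_coe] at hab hab'
    have heq := Sym2.eq_iff.1 (show s(a, b) = s(a', b') from heq)
    rcases heq with ⟨rfl, rfl⟩ | ⟨rfl, rfl⟩
    · rfl
    · exact absurd hab'.2 (disjoint_left.1 h3 hab.1)
  have hcover : (univ : Finset (α → Fin r)) ⊆ T.biUnion F := by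
    intro c _
    obtain ⟨A, B, hA, hB, hd, i, hi⟩ := hcon c
    rw [mem_biUnion]
    refine ⟨((A, B), i), by simp [T, hA, hB, hd], ?_⟩
    simp only [F, E, mem_filter, mem_univ, true_and, mem_image, mem_product]
    rintro e ⟨⟨a, b⟩, ⟨ha, hb⟩, rfl⟩
    exact hi a ha b hb
  have h1 : r ^ Fintype.card α ≤ ∑ t ∈ T, (F t).card := by
    have := (card_le_card hcover).trans card_biUnion_le
    simpa using this
  by_cases hT : T.Nonempty
  · obtain ⟨t0, ht0⟩ := hT
    have hle : m * m ≤ Fintype.card α := by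
      rw [← hE t0 ht0]; exact card_le_univ _
    have h2 : ∑ t ∈ T, (F t).card = T.card * ((r - 1) ^ (m * m) * r ^ (Fintype.card α - m * m)) := by
      rw [← smul_eq_mul, ← sum_const]
      refine sum_congr rfl fun t ht => ?_
      have := card_avoid (E t.1) t.2
      rw [hE t ht] at this
      convert this
    have h3 : T.card ≤ 4 ^ n * r := by
      refine (card_le_univ T).trans ?_
      simp only [Fintype.card_prod, Fintype.card_finset, Fintype.card_fin]
      rw [← mul_pow]
      norm_num
    have hpos : 0 < r ^ (Fintype.card α - m * m) := by positivity
    have h4 : r ^ Fintype.card α = r ^ (m * m) * r ^ (Fintype.card α - m * m) := by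
      rw [← pow_add]; congr 1; omega
    rw [h2, h4, ← mul_assoc] at h1
    have h5 := Nat.le_of_mul_le_mul_right h1 hpos
    have h6 := Nat.mul_le_mul_right ((r - 1) ^ (m * m)) h3
    omega
  · rw [not_nonempty_iff_eq_empty] at hT
    rw [hT] at h1
    simp at h1
    have := h1.1
    omega

theorem exists_L (r : ℕ) (hr : 2 ≤ r) : ∃ L, 4 * r * (r - 1) ^ L < r ^ L := by
  have hr0 : (0 : ℝ) < r := by positivity
  have hq : ((r - 1 : ℕ) : ℝ) / r < 1 := by
    rw [div_lt_one hr0]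
    exact_mod_cast (by omega : r - 1 < r)
  obtain ⟨L, hL⟩ := exists_pow_lt_of_lt_one (show (0 : ℝ) < 1 / (4 * r) by positivity) hq
  refine ⟨L, ?_⟩
  rw [div_pow, div_lt_div_iff₀ (by positivity) (by positivity)] at hL
  have : (4 * r * (r - 1 : ℕ) ^ L : ℝ) < r ^ L := by linarith
  exact_mod_cast this

theorem L_ineq {r L n M : ℕ} (hr : 2 ≤ r) (hL : 4 * r * (r - 1) ^ L < r ^ L) (hn : 1 ≤ n)
    (hM : L * n ≤ M) : 4 ^ n * r * (r - 1) ^ M < r ^ M := by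
  obtain ⟨d, rfl⟩ := Nat.exists_eq_add_of_le hM
  have h1 : (4 * r * (r - 1) ^ L) ^ n < (r ^ L) ^ n := Nat.pow_lt_pow_left hL (by omega)
  have h2 : 4 ^ n * r * (r - 1) ^ (L * n) ≤ (4 * r * (r - 1) ^ L) ^ n := by
    rw [mul_pow, mul_pow, ← pow_mul]
    gcongr
    exact Nat.le_self_pow (by omega) r
  have h3 : 4 ^ n * r * (r - 1) ^ (L * n) < r ^ (L * n) := by
    rw [pow_mul r]; exact h2.trans_lt h1
  calc 4 ^ n * r * (r - 1) ^ (L * n + d) = (4 ^ n * r * (r - 1) ^ (L * n)) * (r - 1) ^ d := by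
        rw [pow_add]; ring
    _ ≤ (4 ^ n * r * (r - 1) ^ (L * n)) * r ^ d := by
        gcongr; omega
    _ < r ^ (L * n) * r ^ d := by
        have : 0 < r ^ d := by positivity
        exact Nat.mul_lt_mul_of_pos_right h3 this
    _ = r ^ (L * n + d) := by rw [pow_add]

theorem bdd {n r : ℕ} (b : SimpleGraph (Fin n) → ℕ) (Q : (Fin r → SimpleGraph (Fin n)) → Prop) :
    BddAbove {s | ∃ G : Fin r → SimpleGraph (Fin n), Q G ∧ ∏ i, b (G i) = s} := by
  apply Set.Finite.bddAbove
  refine (Set.finite_range (fun G : Fin r → SimpleGraph (Fin n) => ∏ i, b (G i))).subset ?_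
  rintro s ⟨G, _, rfl⟩
  exact ⟨G, rfl⟩

theorem part1 {n r : ℕ} (b : SimpleGraph (Fin n) → ℕ) (hb : b ⊥ = 0)
    (hex : ∃ G : Fin r → SimpleGraph (Fin n), IsNDDecomp G) :
    NGprodUp b r = NGprodUpND b r := by
  unfold NGprodUp NGprodUpND
  obtain ⟨G0, hG0⟩ := hex
  apply le_antisymm
  · refine csSup_le ⟨∏ i, b (G0 i), G0, hG0.1, rfl⟩ ?_
    rintro s ⟨G, hG, rfl⟩
    by_cases hd : ∀ i, G i ≠ ⊥
    · exact le_csSup (bdd b _) ⟨G, ⟨hG, hd⟩, rfl⟩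
    · push Not at hd
      obtain ⟨i, hi⟩ := hd
      rw [prod_eq_zero (mem_univ i) (by rw [hi, hb])]
      exact Nat.zero_le _
  · refine csSup_le_csSup (bdd b _) ⟨∏ i, b (G0 i), G0, hG0, rfl⟩ ?_
    rintro s ⟨G, hG, rfl⟩
    exact ⟨G, hG.1, rfl⟩

def colG {n r : ℕ} (c : Sym2 (Fin n) → Fin r) (i : Fin r) : SimpleGraph (Fin n) where
  Adj u v := u ≠ v ∧ c s(u, v) = i
  symm := ⟨fun u v h => ⟨h.1.symm, by rw [Sym2.eq_swap]; exact h.2⟩⟩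
  loopless := ⟨fun u h => h.1 rfl⟩

theorem colG_decomp {n r : ℕ} (c : Sym2 (Fin n) → Fin r) : IsDecomp (colG c) := by
  constructor
  · intro i j hij
    rw [disjoint_iff]
    ext u v
    simp only [SimpleGraph.inf_adj, SimpleGraph.bot_adj, iff_false, colG]
    rintro ⟨⟨_, h1⟩, _, h2⟩
    exact hij (h1.symm.trans h2)
  · ext u v
    simp [SimpleGraph.iSup_adj, colG]

theorem prod_lower {r L n : ℕ} (hr : 2 ≤ r) (hL : 4 * r * (r - 1) ^ L < r ^ L) (hn : 1 ≤ n)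
    (P : ℕ → (N : ℕ) → SimpleGraph (Fin N) → Prop)
    (hP : ∀ k N H, P k N H → IsKTreeOrd k N H)
    (hP2 : ∀ n, 2 ≤ n → P (n - 1) n ⊤) :
    (n - 3 * (Nat.sqrt (L * n) + 1)) ^ r ≤ NGprodUp (widthParam P n) r := by
  set m := Nat.sqrt (L * n) + 1 with hm
  have hM : L * n ≤ m * m := (Nat.lt_succ_sqrt _).le
  obtain ⟨c, hc⟩ := exists_coloring hr (L_ineq hr hL hn hM)
  unfold NGprodUp
  refine le_trans ?_ (le_csSup (bdd _ _) ⟨colG c, colG_decomp c, rfl⟩)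
  have : (n - 3 * m) ^ r = ∏ _i : Fin r, (n - 3 * m) := by simp
  rw [this]
  refine prod_le_prod' fun i _ => ?_
  apply tw_lower (by omega) _ _ P hP hP2
  intro A B hA hB hd
  obtain ⟨a, ha, b, hb, h⟩ := hc A B hA hB hd i
  refine ⟨a, ha, b, hb, ?_, h⟩
  rintro rfl
  exact disjoint_left.1 hd ha hb

theorem prod_upper {r n : ℕ} 
    (P : ℕ → (N : ℕ) → SimpleGraph (Fin N) → Prop)
    (hP2 : ∀ n, 2 ≤ n → P (n - 1) n ⊤) :
    NGprodUp (widthParam P n) r ≤ n ^ r := by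
  unfold NGprodUp
  apply csSup_le'
  rintro s ⟨G, _, rfl⟩
  have : n ^ r = ∏ _i : Fin r, n := by simp
  rw [this]
  exact prod_le_prod' fun i _ => width_upper (G i) P hP2

theorem lim_aux (L : ℕ) : Filter.Tendsto
    (fun n : ℕ => ((n - 3 * (Nat.sqrt (L * n) + 1) : ℕ) : ℝ) / n) Filter.atTop (nhds 1) := by
  have h1 : Filter.Tendsto (fun n : ℕ => (1 : ℝ) - 3 * (Real.sqrt L * (Real.sqrt n)⁻¹ + (n : ℝ)⁻¹))
      Filter.atTop (nhds 1) := by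
    have ha : Filter.Tendsto (fun n : ℕ => (Real.sqrt (n : ℝ))⁻¹) Filter.atTop (nhds 0) :=
      tendsto_inv_atTop_zero.comp (Real.tendsto_sqrt_atTop.comp tendsto_natCast_atTop_atTop)
    have hb : Filter.Tendsto (fun n : ℕ => ((n : ℝ))⁻¹) Filter.atTop (nhds 0) :=
      tendsto_inv_atTop_zero.comp tendsto_natCast_atTop_atTop
    have := ((ha.const_mul (Real.sqrt L)).add hb).const_mul 3 |>.const_sub 1
    simpa using this
  refine tendsto_of_tendsto_of_tendsto_of_le_of_le' h1 tendsto_const_nhds ?_ ?_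
  · filter_upwards [Filter.eventually_ge_atTop 1] with n hn
    have hn0 : (0 : ℝ) < n := by exact_mod_cast hn
    rw [le_div_iff₀ hn0]
    have hs : (Nat.sqrt (L * n) : ℝ) ≤ Real.sqrt L * Real.sqrt n := by
      rw [← Real.sqrt_mul (by positivity)]
      have := Real.nat_sqrt_le_real_sqrt (a := L * n)
      push_cast at this
      exact this
    have h2 : (n : ℝ) - 3 * (Nat.sqrt (L * n) + 1) ≤ ((n - 3 * (Nat.sqrt (L * n) + 1) : ℕ) : ℝ) := by
      have : n ≤ (n - 3 * (Nat.sqrt (L * n) + 1)) + 3 * (Nat.sqrt (L * n) + 1) := by omega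
      have : (n : ℝ) ≤ ((n - 3 * (Nat.sqrt (L * n) + 1) : ℕ) : ℝ) + 3 * (Nat.sqrt (L * n) + 1) := by
        exact_mod_cast this
      linarith
    refine le_trans (le_of_eq_of_le ?_ (sub_le_sub_left (mul_le_mul_of_nonneg_left (add_le_add_left hs 1) (by norm_num : (0:ℝ) ≤ 3)) (n : ℝ))) h2
    have h3 : (Real.sqrt n)⁻¹ * n = Real.sqrt n := by
      have hp : 0 < Real.sqrt n := Real.sqrt_pos.2 hn0
      rw [inv_mul_eq_div, div_eq_iff hp.ne', Real.mul_self_sqrt hn0.le]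
    have h4 : (n : ℝ)⁻¹ * n = 1 := inv_mul_cancel₀ hn0.ne'
    linear_combination (-3 * Real.sqrt L) * h3 - 3 * h4
  · filter_upwards [Filter.eventually_ge_atTop 1] with n hn
    have hn0 : (0 : ℝ) < n := by exact_mod_cast hn
    rw [div_le_one hn0]
    exact_mod_cast Nat.sub_le _ _

theorem main (r : ℕ) (hr : 2 ≤ r)
    (P : ℕ → (N : ℕ) → SimpleGraph (Fin N) → Prop)
    (hP : ∀ k N H, P k N H → IsKTreeOrd k N H)
    (hP2 : ∀ n, 2 ≤ n → P (n - 1) n ⊤) :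
    (∀ n : ℕ, (∃ G : Fin r → SimpleGraph (Fin n), IsNDDecomp G) →
      NGprodUp (widthParam P n) r = NGprodUpND (widthParam P n) r) ∧
    Filter.Tendsto (fun n : ℕ => (NGprodUp (widthParam P n) r : ℝ) / (n : ℝ) ^ r)
      Filter.atTop (nhds 1) := by
  refine ⟨fun n h => part1 _ (by simp [widthParam]) h, ?_⟩
  obtain ⟨L, hL⟩ := exists_L r hr
  have h1 := (lim_aux L).pow r
  rw [one_pow] at h1
  refine tendsto_of_tendsto_of_tendsto_of_le_of_le' h1 tendsto_const_nhds ?_ ?_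
  · filter_upwards [Filter.eventually_ge_atTop 1] with n hn
    rw [div_pow]
    gcongr
    exact_mod_cast prod_lower hr hL hn P hP hP2
  · filter_upwards [Filter.eventually_ge_atTop 1] with n hn
    have hn0 : (0 : ℝ) < n := by exact_mod_cast hn
    rw [div_le_one (by positivity)]
    exact_mod_cast prod_upper P hP2

end NGaux

/-- For `β ∈ {tw, la, pw, ppw}` and fixed `r ≥ 2`: `NGΠ↑_β(r;n) = NGΠ↑ⁿ_β(r;n)`
whenever a non-degenerate `r`-decomposition of `K_n` exists, and
`lim_{n→∞} NGΠ↑_β(r;n)/nʳ = 1`. -/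
theorem statement12 (r : ℕ) (hr : 2 ≤ r)
    (β : (n : ℕ) → SimpleGraph (Fin n) → ℕ)
    (hβ : β = NG.treewidth ∨ β = NG.la ∨ β = NG.pw ∨ β = NG.ppw) :
    (∀ n : ℕ, (∃ G : Fin r → SimpleGraph (Fin n), NG.IsNDDecomp G) →
      NG.NGprodUp (β n) r = NG.NGprodUpND (β n) r) ∧
    Filter.Tendsto (fun n : ℕ => (NG.NGprodUp (β n) r : ℝ) / (n : ℝ) ^ r)
      Filter.atTop (nhds 1) := by
  rcases hβ with rfl | rfl | rfl | rfl
  · exact NGaux.main r hr NG.IsKTreeOrd (fun _ _ _ h => h) NGaux.ktree_top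
  · exact NGaux.main r hr NG.IsTwoSidedKTreeOrd (fun _ _ _ h => h.1)
      (fun n hn => ⟨NGaux.ktree_top n hn, fun j hj => by omega⟩)
  · exact NGaux.main r hr NG.IsCaterpillarOrd (fun _ _ _ h => h.1)
      (fun n hn => ⟨NGaux.ktree_top n hn, fun i j _ hj => by omega⟩)
  · exact NGaux.main r hr NG.IsLinearKTreeOrd (fun _ _ _ h => h.1)
      (fun n hn => ⟨NGaux.ktree_top n hn, fun i j _ hj => by omega⟩)
end

section
/- Fix integers r ≥ 2 and n ≥ 2, and let a_1, a_2, …, a_r be integers with 1 ≤ a_i ≤ n for all i. Let σ = a_1 + ⋯ + a_r and π = a_1·a_2⋯a_r. Set q = ⌊(σ − r)/(n − 1)⌋ and ρ = σ − r − q(n − 1) + 1. Then n^q · ρ ≤ π. -/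
open scoped Classical

theorem step14 (m S b : ℕ) (hm : 0 < m) (hb : b ≤ m) :
    (m+1)^((S+b)/m) * ((S+b)%m+1) ≤ ((m+1)^(S/m) * (S%m+1)) * (b+1) := by
  have hs := Nat.mod_lt S hm
  have hd := Nat.div_add_mod S m
  generalize S/m = q at *
  generalize S%m = s at *
  subst hd
  by_cases h : s + b < m
  · have h1 : (m*q+s+b)/m = q := by
      rw [add_assoc, Nat.mul_add_div hm, Nat.div_eq_of_lt h, add_zero]
    have h2 : (m*q+s+b)%m = s+b := by
      rw [add_assoc, Nat.mul_add_mod, Nat.mod_eq_of_lt h]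
    rw [h1, h2, mul_assoc]
    apply Nat.mul_le_mul_left
    nlinarith [Nat.zero_le (s*b)]
  · obtain ⟨t, ht⟩ := Nat.exists_eq_add_of_le (not_lt.mp h)
    have e : m*q+s+b = m*(q+1)+t := by rw [add_assoc, ht]; ring
    have htm : t < m := by omega
    rw [e, Nat.mul_add_div hm, Nat.div_eq_of_lt htm, Nat.mul_add_mod, Nat.mod_eq_of_lt htm,
      add_zero, pow_succ, mul_assoc, mul_assoc]
    apply Nat.mul_le_mul_left
    obtain ⟨u, rfl⟩ := Nat.exists_eq_add_of_lt hs
    obtain ⟨v, hv⟩ := Nat.exists_eq_add_of_le hb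
    have hb' : b = t + u + 1 := by omega
    have hs' : s = t + v := by omega
    subst hb' hs'
    nlinarith [Nat.zero_le (u*v)]

theorem main14 {ι : Type} (m : ℕ) (hm : 0 < m) (b : ι → ℕ) (hb : ∀ i, b i ≤ m) (T : Finset ι) :
    (m+1)^((∑ i ∈ T, b i)/m) * ((∑ i ∈ T, b i)%m+1) ≤ ∏ i ∈ T, (b i + 1) := by
  classical
  induction T using Finset.induction_on with
  | empty => simp
  | insert i T hi ih =>
    rw [Finset.sum_insert hi, Finset.prod_insert hi, add_comm (b i), mul_comm (b i + 1)]
    exact (step14 m _ (b i) hm (hb i)).trans (Nat.mul_le_mul_right _ ih)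

/-- For integers `r ≥ 2`, `n ≥ 2`, and `1 ≤ aᵢ ≤ n`: with `σ = Σaᵢ`,
`q = ⌊(σ−r)/(n−1)⌋` and `ρ = σ − r − q(n−1) + 1`, one has `n^q·ρ ≤ Πaᵢ`. -/
theorem statement14 (r n : ℕ) (hr : 2 ≤ r) (hn : 2 ≤ n) (a : Fin r → ℕ)
    (ha1 : ∀ i, 1 ≤ a i) (han : ∀ i, a i ≤ n) :
    n ^ (((∑ i, a i) - r) / (n - 1)) *
      (((∑ i, a i) - r - (((∑ i, a i) - r) / (n - 1)) * (n - 1)) + 1) ≤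
      ∏ i, a i := by
  have h := main14 (n-1) (by omega) (fun i => a i - 1)
    (fun i => Nat.sub_le_sub_right (han i) 1) Finset.univ
  have e1 : ∀ i, a i - 1 + 1 = a i := fun i => Nat.sub_add_cancel (ha1 i)
  have e2 : ∑ i, (a i - 1) = (∑ i, a i) - r := by
    have : ∑ i, (a i - 1 + 1) = ∑ i, a i := Finset.sum_congr rfl (fun i _ => e1 i)
    rw [Finset.sum_add_distrib] at this
    simp at this
    omega
  simp only [e1, e2] at h
  rw [Nat.sub_add_cancel (by omega : 1 ≤ n)] at h
  rw [Nat.mod_eq_sub_div_mul] at h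
  exact h
end
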